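/- arXiv:1908.11455 — 2 statements merged into one kernel-verified Lean document; each statement's English description precedes it below -/
import Mathlib

section
/- If the support of w ∈ S_∞ has fewer than ℓ(w) elements, then w is not λ-maximal for any partition λ of ℓ(w); that is, a_{w,λ} < f^λ for every λ with |λ| = ℓ(w) and a_{w,λ} > 0 possible only with strict inequality. -/
open Equiv

/-- The simple transposition `sᵢ = (i, i+1)` in `S_∞` (realized as `Equiv.Perm ℕ`). -/
def EGs (i : ℕ) : Equiv.Perm ℕ := Equiv.swap i (i + 1)

/-- Coxeter length: the minimal length of a word in the simple transpositions for `w`. -/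
noncomputable def coxLength (w : Equiv.Perm ℕ) : ℕ :=
  sInf {k | ∃ l : List ℕ, (l.map EGs).prod = w ∧ l.length = k}

/-- `l` is a reduced word for `w`. -/
def IsReducedWord (w : Equiv.Perm ℕ) (l : List ℕ) : Prop :=
  (l.map EGs).prod = w ∧ l.length = coxLength w

/-- Top-to-bottom, right-to-left reading word of a filling of `μ`. -/
def readingWord (μ : YoungDiagram) (T : ℕ → ℕ → ℕ) : List ℕ :=
  (List.range (μ.colLen 0)).flatMap fun i =>
    ((List.range (μ.rowLen i)).reverse).map fun j => T i j

/-- Standard Young tableaux of shape `μ`, as entry functions: strictly increasing along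
rows and columns, zero outside `μ`, and the labels on the cells are exactly `1,…,|μ|`. -/
def SYTset (μ : YoungDiagram) : Set (ℕ → ℕ → ℕ) :=
  {T | (∀ i j1 j2, j1 < j2 → (i, j2) ∈ μ.cells → T i j1 < T i j2) ∧
       (∀ i1 i2 j, i1 < i2 → (i2, j) ∈ μ.cells → T i1 j < T i2 j) ∧
       (∀ i j, (i, j) ∉ μ.cells → T i j = 0) ∧
       μ.cells.image (fun c => T c.1 c.2) = Finset.Icc 1 μ.card}

/-- Edelman–Greene tableaux of type `(μ, w)`, as entry functions: strictly increasing
along rows and columns, zero outside `μ`, whose reading word is a reduced word of `w`. -/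
def EGset (μ : YoungDiagram) (w : Equiv.Perm ℕ) : Set (ℕ → ℕ → ℕ) :=
  {T | (∀ i j1 j2, j1 < j2 → (i, j2) ∈ μ.cells → T i j1 < T i j2) ∧
       (∀ i1 i2 j, i1 < i2 → (i2, j) ∈ μ.cells → T i1 j < T i2 j) ∧
       (∀ i j, (i, j) ∉ μ.cells → T i j = 0) ∧
       IsReducedWord w (readingWord μ T)}

/-- Standardization: the cell `(i,j)` receives the rank of its entry, where equal
entries are ordered left to right (by column). -/
def stdEntry (μ : YoungDiagram) (T : ℕ → ℕ → ℕ) (i j : ℕ) : ℕ :=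
  if (i, j) ∈ μ.cells then
    (μ.cells.filter fun c =>
      T c.1 c.2 < T i j ∨ (T c.1 c.2 = T i j ∧ c.2 < j) ∨
        (T c.1 c.2 = T i j ∧ c.2 = j ∧ c.1 ≤ i)).card
  else 0

/-- `k` is a descent of the standard tableau `U`: the cell labeled `k - 1` lies weakly
east of the cell labeled `k`. -/
def IsDescent (μ : YoungDiagram) (U : ℕ → ℕ → ℕ) (k : ℕ) : Prop :=
  ∃ c ∈ μ.cells, ∃ c' ∈ μ.cells, U c.1 c.2 = k ∧ U c'.1 c'.2 = k - 1 ∧ c.2 ≤ c'.2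

open scoped Classical in
/-- The sweep map: a cell's entry is one plus the number of descents of `U` that are
at most its label in `U`. -/
noncomputable def sweepEntry (μ : YoungDiagram) (U : ℕ → ℕ → ℕ) (i j : ℕ) : ℕ :=
  if (i, j) ∈ μ.cells then
    ((Finset.Icc 1 (U i j)).filter fun k => IsDescent μ U k).card + 1
  else 0

/-- `w` is totally commutative: it has a reduced word whose letters are pairwise
at distance at least `2`. -/
def TotallyCommutative (w : Equiv.Perm ℕ) : Prop :=
  ∃ l : List ℕ, IsReducedWord w l ∧ l.Pairwise fun a b => 2 ≤ Nat.dist a b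

namespace EGAux

/-- The permutation of a word. -/
def wp (l : List ℕ) : Equiv.Perm ℕ := (l.map EGs).prod

/-- A word of minimal length among the words of its permutation. -/
def Red (l : List ℕ) : Prop := ∀ l', wp l' = wp l → l.length ≤ l'.length

lemma wp_nil : wp [] = 1 := rfl
lemma wp_cons (x : ℕ) (l : List ℕ) : wp (x :: l) = EGs x * wp l := by simp [wp]
lemma wp_append (l l' : List ℕ) : wp (l ++ l') = wp l * wp l' := by simp [wp]
lemma wp_single (x : ℕ) : wp [x] = EGs x := by simp [wp]
lemma EGs_mul_self (x : ℕ) : EGs x * EGs x = 1 := by simp [EGs]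

lemma EGs_apply (c x : ℕ) : EGs c x = if x = c then c + 1 else if x = c + 1 then c else x := by
  simp [EGs, Equiv.swap_apply_def]

lemma red_of_isReducedWord {w : Equiv.Perm ℕ} {l : List ℕ} (h : IsReducedWord w l) : Red l := by
  intro l' hl'
  rw [h.2]
  exact Nat.sInf_le ⟨l', by rw [← h.1]; exact hl', rfl⟩

lemma exchange (a : List ℕ) (c : ℕ) (h : wp a (c + 1) < wp a c) :
    ∃ a', a'.Sublist a ∧ a'.length + 1 = a.length ∧ wp a' = wp a * EGs c := by
  induction a with
  | nil => simp [wp_nil] at h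
  | cons x t ih =>
    by_cases ht : wp t (c + 1) < wp t c
    · obtain ⟨a', h1, h2, h3⟩ := ih ht
      exact ⟨x :: a', h1.cons_cons x, by simp [h2], by rw [wp_cons, wp_cons, h3, mul_assoc]⟩
    · have hne : wp t c ≠ wp t (c + 1) := fun h => by
        have := (wp t).injective h
        omega
      rw [wp_cons, Equiv.Perm.mul_apply, Equiv.Perm.mul_apply, EGs_apply, EGs_apply] at h
      have h1 : wp t c = x := by grind
      have h2 : wp t (c + 1) = x + 1 := by grind
      refine ⟨t, List.sublist_cons_self x t, by simp, ?_⟩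
      have key : EGs x * wp t = wp t * EGs c := by
        have := Equiv.mul_swap_eq_swap_mul (wp t) c (c + 1)
        rw [h1, h2] at this
        exact this.symm
      rw [wp_cons, key, mul_assoc, EGs_mul_self, mul_one]

lemma Red.initial {u v : List ℕ} (h : Red (u ++ v)) : Red u := by
  intro l' hl'
  have := h (l' ++ v) (by rw [wp_append, wp_append, hl'])
  simpa using this

lemma Red.descent {u : List ℕ} {c : ℕ} (h : Red (u ++ [c])) :
    wp (u ++ [c]) (c + 1) < wp (u ++ [c]) c := by
  by_contra hlt
  have hne : wp (u ++ [c]) c ≠ wp (u ++ [c]) (c + 1) := fun h => by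
    have := (wp (u ++ [c])).injective h
    omega
  have h1 : wp u (c + 1) < wp u c := by
    have e1 : wp (u ++ [c]) c = wp u (c + 1) := by simp [wp_append, wp_single, EGs_apply]
    have e2 : wp (u ++ [c]) (c + 1) = wp u c := by simp [wp_append, wp_single, EGs_apply]
    omega
  obtain ⟨a', -, h3, h4⟩ := exchange u c h1
  have := h a' (by rw [h4, wp_append, wp_single])
  simp at this
  omega

lemma peel (u v : List ℕ) (h : Red (u ++ v)) : ∀ a, wp a = wp (u ++ v) →
    ∃ a', a'.Sublist a ∧ a'.length + v.length = a.length ∧ wp a' = wp u := by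
  induction v using List.reverseRecOn with
  | nil => exact fun a ha => ⟨a, List.Sublist.refl a, by simp, by simpa using ha⟩
  | append_singleton v c ih =>
    intro a ha
    rw [← List.append_assoc] at h ha
    have hd := h.descent
    rw [← ha] at hd
    obtain ⟨a1, h1, h2, h3⟩ := exchange a c hd
    rw [ha, wp_append _ [c], wp_single, mul_assoc, EGs_mul_self, mul_one] at h3
    obtain ⟨a2, k1, k2, k3⟩ := ih h.initial a1 h3
    exact ⟨a2, k1.trans h1, by simp; omega, k3⟩

lemma letters_ge (m : ℕ) (a : List ℕ) (h : Red a) (hf : ∀ x < m, wp a x = x) :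
    ∀ c ∈ a, m ≤ c := by
  induction a using List.reverseRecOn with
  | nil => simp
  | append_singleton a c ih =>
    have hd := h.descent
    have hc : m ≤ c := by
      by_contra hc
      have h1 := hf c (by omega)
      rw [h1] at hd
      have h2 := hf _ (lt_of_lt_of_le hd (by omega))
      have := (wp (a ++ [c])).injective h2
      omega
    have := ih h.initial (fun x hx => by
      have := hf x hx
      rw [wp_append, wp_single, Equiv.Perm.mul_apply, EGs_apply, if_neg (by omega),
        if_neg (by omega)] at this
      exact this)
    grind

lemma wp_fix (m : ℕ) (a : List ℕ) (h : ∀ c ∈ a, m ≤ c) : ∀ x < m, wp a x = x := by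
  induction a with
  | nil => simp [wp_nil]
  | cons c t ih =>
    intro x hx
    rw [wp_cons, Equiv.Perm.mul_apply, ih (fun d hd => h d (by simp [hd])) x hx, EGs_apply]
    have := h c (by simp)
    grind

lemma EGs_comm {x y : ℕ} (h : x + 2 ≤ y) : Commute (EGs x) (EGs y) := by
  ext z
  simp only [Equiv.Perm.mul_apply, EGs_apply]
  grind

lemma factor (m : ℕ) (b : List ℕ) (h : b.Pairwise fun x y => ¬ (x = m ∧ y = m + 1)) :
    wp (b.filter (fun x => !decide (x ≤ m)) ++ b.filter (fun x => decide (x ≤ m))) = wp b := by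
  induction b with
  | nil => rfl
  | cons x t ih =>
    rw [List.pairwise_cons] at h
    have ih := ih h.2
    rw [wp_append] at ih ⊢
    by_cases hx : x ≤ m
    · have hc : Commute (EGs x) (wp (t.filter (fun x => !decide (x ≤ m)))) := by
        apply Commute.list_prod_right
        intro y hy
        simp only [List.mem_map, List.mem_filter] at hy
        obtain ⟨z, ⟨hz, hzm⟩, rfl⟩ := hy
        have := h.1 z hz
        simp at hzm
        exact EGs_comm (by omega)
      simp only [List.filter_cons, hx, decide_true, Bool.not_true, Bool.false_eq_true, if_true,
        if_false, wp_cons]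
      rw [← ih, ← mul_assoc, ← hc.eq, mul_assoc]
    · simp only [List.filter_cons, hx, decide_false, Bool.not_false, Bool.false_eq_true, if_true,
        if_false, wp_cons]
      rw [← ih, mul_assoc]

lemma len_split (m : ℕ) (l : List ℕ) : l.length =
    l.countP (fun x => decide (x ≤ m)) + l.countP (fun x => !decide (x ≤ m)) := by
  induction l with
  | nil => rfl
  | cons x t ih =>
    rw [List.countP_cons, List.countP_cons, List.length_cons]
    by_cases h : x ≤ m <;> simp [h] at ih ⊢ <;> omega

lemma count_le (m : ℕ) (a b : List ℕ) (ha : Red a) (hb : Red b) (hab : wp a = wp b)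
    (h : b.Pairwise fun x y => ¬ (x = m ∧ y = m + 1)) :
    a.countP (fun x => decide (x ≤ m)) ≤ b.countP (fun x => decide (x ≤ m)) := by
  set u := b.filter (fun x => !decide (x ≤ m)) with hu
  set v := b.filter (fun x => decide (x ≤ m)) with hv
  have hf : wp (u ++ v) = wp b := factor m b h
  have hlen : (u ++ v).length = b.length := by
    have := len_split m b
    rw [List.countP_eq_length_filter, List.countP_eq_length_filter] at this
    simp only [hu, hv, List.length_append]
    omega
  have hR : Red (u ++ v) := by
    intro l' hl'
    rw [hlen]
    exact hb l' (hl'.trans hf)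
  have hal : a.length = b.length := le_antisymm (ha b hab.symm) (hb a hab)
  obtain ⟨a', h1, h2, h3⟩ := peel u v hR a (hab.trans hf.symm)
  have hR' : Red a' := by
    intro l' hl'
    have := hR.initial l' (hl'.trans h3)
    simp at hlen
    omega
  have hge := letters_ge (m + 1) a' hR' (by
    rw [h3]
    refine wp_fix (m + 1) u (fun c hc => ?_)
    simp [hu] at hc
    omega)
  have e1 := len_split m a
  have e2 := h1.countP_le (p := fun x => !decide (x ≤ m))
  have e3 : a'.countP (fun x => !decide (x ≤ m)) = a'.length := by
    rw [List.countP_eq_length]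
    intro x hx
    have := hge x hx
    simp
    omega
  have e4 : b.countP (fun x => decide (x ≤ m)) = v.length := List.countP_eq_length_filter
  simp only [e4]
  omega

lemma wp_preserve (c : ℕ) (a : List ℕ) (h : c ∉ a) : ∀ x, wp a x ≤ c ↔ x ≤ c := by
  induction a with
  | nil => simp [wp_nil]
  | cons d t ih =>
    intro x
    have hd : c ≠ d := fun e => h (by simp [e])
    rw [← ih (fun e => h (by simp [e])) x, wp_cons, Equiv.Perm.mul_apply, EGs_apply]
    grind

lemma mem_of_nodup (r l : List ℕ) (hr : r.Nodup) (h : wp r = wp l) : ∀ c ∈ r, c ∈ l := by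
  intro c hc
  by_contra hcl
  obtain ⟨x, y, rfl⟩ := List.append_of_mem hc
  have hx : c ∉ x := by
    intro hx
    have := List.nodup_append.1 hr
    exact this.2.2 c hx c (by simp) rfl
  have hy : c ∉ y := (List.nodup_cons.1 (List.nodup_append.1 hr).2.1).1
  have h1 := wp_preserve c l hcl ((wp y).symm c)
  rw [← h, wp_append, wp_cons, Equiv.Perm.mul_apply, Equiv.Perm.mul_apply, Equiv.apply_symm_apply,
    wp_preserve c x hx, EGs_apply] at h1
  have h2 := wp_preserve c y hy ((wp y).symm c)
  rw [Equiv.apply_symm_apply] at h2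
  simp at h1 h2
  omega

/-- The cells of `μ` in reading order. -/
def cellList (μ : YoungDiagram) : List (ℕ × ℕ) :=
  (List.range (μ.colLen 0)).flatMap fun i =>
    ((List.range (μ.rowLen i)).reverse).map fun j => (i, j)

lemma readingWord_eq (μ : YoungDiagram) (T : ℕ → ℕ → ℕ) :
    readingWord μ T = (cellList μ).map fun c => T c.1 c.2 := by
  simp [readingWord, cellList, List.map_flatMap, Function.comp_def]

lemma mem_cellList (μ : YoungDiagram) (c : ℕ × ℕ) : c ∈ cellList μ ↔ c ∈ μ.cells := by
  obtain ⟨i, j⟩ := c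
  simp only [cellList, List.mem_flatMap, List.mem_range, List.mem_map, List.mem_reverse,
    Prod.mk.injEq, YoungDiagram.mem_cells]
  constructor
  · rintro ⟨i', -, j', h, rfl, rfl⟩
    exact YoungDiagram.mem_iff_lt_rowLen.2 h
  · intro h
    exact ⟨i, YoungDiagram.mem_iff_lt_colLen.1 (μ.up_left_mem le_rfl (Nat.zero_le j) h), j,
      YoungDiagram.mem_iff_lt_rowLen.1 h, rfl, rfl⟩

lemma pairwise_cellList (μ : YoungDiagram) :
    (cellList μ).Pairwise fun c d => c.1 < d.1 ∨ (c.1 = d.1 ∧ d.2 < c.2) := by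
  rw [cellList, List.pairwise_flatMap]
  constructor
  · intro i _
    rw [List.pairwise_map, List.pairwise_reverse]
    exact List.pairwise_lt_range.imp (fun h => Or.inr ⟨rfl, h⟩)
  · refine List.pairwise_lt_range.imp (fun h => ?_)
    simp only [List.mem_map]
    rintro _ ⟨_, -, rfl⟩ _ ⟨_, -, rfl⟩
    exact Or.inl h

lemma nodup_cellList (μ : YoungDiagram) : (cellList μ).Nodup := by
  refine (pairwise_cellList μ).imp ?_
  rintro c d h rfl
  omega

section rank
variable {β : Type} [LinearOrder β]

/-- Rank of a cell of `μ` with respect to a key. -/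
def rk (μ : YoungDiagram) (f : ℕ × ℕ → β) (i j : ℕ) : ℕ :=
  if (i, j) ∈ μ.cells then (μ.cells.filter fun c => f c ≤ f (i, j)).card else 0

lemma rk_le (μ : YoungDiagram) (f : ℕ × ℕ → β) {c d : ℕ × ℕ} (hc : c ∈ μ.cells)
    (hd : d ∈ μ.cells) : rk μ f c.1 c.2 ≤ rk μ f d.1 d.2 ↔ f c ≤ f d := by
  simp only [rk, Prod.mk.eta, hc, hd, if_true]
  constructor
  · intro h
    by_contra hlt
    push Not at hlt
    refine absurd h (not_le.2 (Finset.card_lt_card ?_))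
    rw [Finset.ssubset_iff_of_subset]
    · exact ⟨c, by simp [hc], by simp [hlt]⟩
    · intro x hx
      simp only [Finset.mem_filter] at hx ⊢
      exact ⟨hx.1, hx.2.trans hlt.le⟩
  · intro h
    apply Finset.card_le_card
    intro x hx
    simp only [Finset.mem_filter] at hx ⊢
    exact ⟨hx.1, hx.2.trans h⟩

lemma rk_mem (μ : YoungDiagram) (f : ℕ × ℕ → β) (hf : Function.Injective f)
    (hrow : ∀ i j1 j2, j1 < j2 → (i, j2) ∈ μ.cells → f (i, j1) < f (i, j2))
    (hcol : ∀ i1 i2 j, i1 < i2 → (i2, j) ∈ μ.cells → f (i1, j) < f (i2, j)) :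
    rk μ f ∈ SYTset μ := by
  refine ⟨?_, ?_, ?_, ?_⟩
  · intro i j1 j2 h h2
    have h1 : (i, j1) ∈ μ.cells := μ.up_left_mem le_rfl h.le h2
    have := rk_le μ f h2 h1
    have h3 := hrow i j1 j2 h h2
    by_contra hc
    exact absurd (this.1 (not_lt.1 hc)) (not_le.2 h3)
  · intro i1 i2 j h h2
    have h1 : (i1, j) ∈ μ.cells := μ.up_left_mem h.le le_rfl h2
    have := rk_le μ f h2 h1
    have h3 := hcol i1 i2 j h h2
    by_contra hc
    exact absurd (this.1 (not_lt.1 hc)) (not_le.2 h3)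
  · intro i j h
    simp only [rk, h, if_false]
  · apply Finset.eq_of_subset_of_card_le
    · intro x hx
      simp only [Finset.mem_image] at hx
      obtain ⟨c, hc, rfl⟩ := hx
      simp only [rk, Prod.mk.eta, hc, if_true, Finset.mem_Icc]
      constructor
      · exact Finset.card_pos.2 ⟨c, by simp [hc]⟩
      · exact Finset.card_le_card (Finset.filter_subset _ _)
    · rw [Finset.card_image_of_injOn]
      · simp
      · intro c hc d hd h
        simp only at h
        exact hf (le_antisymm ((rk_le μ f hc hd).1 h.le) ((rk_le μ f hd hc).1 h.ge))
end rank

/-- Key of standardization. -/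
def key (T : ℕ → ℕ → ℕ) (c : ℕ × ℕ) : ℕ ×ₗ (ℕ ×ₗ ℕ) := toLex (T c.1 c.2, toLex (c.2, c.1))

lemma key_le (T : ℕ → ℕ → ℕ) (c d : ℕ × ℕ) : key T c ≤ key T d ↔
    (T c.1 c.2 < T d.1 d.2 ∨ (T c.1 c.2 = T d.1 d.2 ∧ c.2 < d.2) ∨
        (T c.1 c.2 = T d.1 d.2 ∧ c.2 = d.2 ∧ c.1 ≤ d.1)) := by
  simp only [key, Prod.Lex.toLex_le_toLex]
  tauto

lemma key_inj (T : ℕ → ℕ → ℕ) : Function.Injective (key T) := by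
  intro c d h
  have h1 := (key_le T c d).1 h.le
  have h2 := (key_le T d c).1 h.ge
  ext <;> omega

lemma key_lt (T : ℕ → ℕ → ℕ) (c d : ℕ × ℕ) (h : T c.1 c.2 < T d.1 d.2) : key T c < key T d := by
  rw [← not_le, key_le]
  omega

lemma finite_SYT (μ : YoungDiagram) : (SYTset μ).Finite := by
  have hfin : (Set.univ.pi fun _ : μ.cells => Set.Iic μ.card).Finite :=
    Set.Finite.pi' (fun _ => Set.finite_Iic _) |>.subset (by intro f hf i; exact hf i trivial)
  refine Set.Finite.of_injOn (f := fun (T : ℕ → ℕ → ℕ) (c : μ.cells) => T c.1.1 c.1.2)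
    (t := Set.univ.pi fun _ => Set.Iic μ.card) ?_ ?_ hfin
  · intro T hT c _
    have : T c.1.1 c.1.2 ∈ μ.cells.image (fun c => T c.1 c.2) :=
      Finset.mem_image_of_mem (fun c : ℕ × ℕ => T c.1 c.2) c.2
    rw [hT.2.2.2] at this
    exact (Finset.mem_Icc.1 this).2
  · intro T hT T' hT' h
    ext i j
    by_cases hc : (i, j) ∈ μ.cells
    · exact congrFun h ⟨(i, j), hc⟩
    · rw [hT.2.2.1 i j hc, hT'.2.2.1 i j hc]

lemma row_le {μ : YoungDiagram} {w : Equiv.Perm ℕ} {T : ℕ → ℕ → ℕ} (hT : T ∈ EGset μ w)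
    {c d : ℕ × ℕ} (hd : d ∈ μ.cells) (h1 : c.1 < d.1) (h2 : c.2 ≤ d.2) :
    T c.1 c.2 < T d.1 d.2 := by
  have hm : (d.1, c.2) ∈ μ.cells := μ.up_left_mem le_rfl h2 hd
  have e1 := hT.2.1 c.1 d.1 c.2 h1 hm
  rcases h2.lt_or_eq with h | h
  · exact e1.trans (hT.1 d.1 c.2 d.2 h hd)
  · rwa [h] at e1 ⊢

lemma inj_aux {μ : YoungDiagram} {w : Equiv.Perm ℕ} {T T' : ℕ → ℕ → ℕ} (hT : T ∈ EGset μ w)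
    (hT' : T' ∈ EGset μ w)
    (hk : ∀ c ∈ μ.cells, ∀ d ∈ μ.cells, (key T c ≤ key T d ↔ key T' c ≤ key T' d))
    (c0 : ℕ × ℕ) (hc0 : c0 ∈ μ.cells) (hlt : T c0.1 c0.2 < T' c0.1 c0.2)
    (hmin : ∀ d ∈ μ.cells, ¬ key T c0 ≤ key T d → T d.1 d.2 = T' d.1 d.2) : False := by
  have hsub : ∀ d ∈ μ.cells, T' d.1 d.2 ≤ T c0.1 c0.2 → T d.1 d.2 = T' d.1 d.2 := by
    intro d hd h
    apply hmin d hd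
    rw [hk c0 hc0 d hd, key_le]
    omega
  have hle := count_le (T c0.1 c0.2) (readingWord μ T) (readingWord μ T')
    (red_of_isReducedWord hT.2.2.2) (red_of_isReducedWord hT'.2.2.2)
    (hT.2.2.2.1.trans hT'.2.2.2.1.symm) (by
      rw [readingWord_eq, List.pairwise_map]
      refine (pairwise_cellList μ).imp_of_mem ?_
      intro c d hc hd hR ⟨h1, h2⟩
      rw [mem_cellList] at hc hd
      have hTc := hsub c hc h1.le
      have a1 : key T c0 ≤ key T d := by
        by_contra hcon
        have := hmin d hd hcon
        apply hcon
        rw [key_le]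
        omega
      have a2 := (key_le _ _ _).1 ((hk _ hc0 _ hd).1 a1)
      have a3 : key T' c ≤ key T' c0 := (key_lt T' c c0 (by omega)).le
      have a4 := (key_le _ _ _).1 ((hk _ hc _ hc0).2 a3)
      have b1 : c.2 ≤ c0.2 := by omega
      have b2 : c0.2 ≤ d.2 := by omega
      have b3 : c0.1 ≤ c.1 := by
        by_contra hcon
        have := row_le hT hc0 (not_le.1 hcon) b1
        omega
      have b4 : d.1 ≤ c0.1 := by
        by_contra hcon
        have := row_le hT' hd (not_le.1 hcon) b2
        omega
      omega)
  rw [readingWord_eq, readingWord_eq, List.countP_map, List.countP_map,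
    List.countP_eq_length_filter, List.countP_eq_length_filter,
    ← List.toFinset_card_of_nodup ((nodup_cellList μ).filter _),
    ← List.toFinset_card_of_nodup ((nodup_cellList μ).filter _)] at hle
  refine absurd hle (not_le.2 (Finset.card_lt_card ?_))
  rw [Finset.ssubset_iff_of_subset]
  · refine ⟨c0, ?_, ?_⟩
    · simp [mem_cellList, -YoungDiagram.mem_cells, hc0]
    · simp [hlt]
  · intro d hd
    simp only [List.mem_toFinset, List.mem_filter, mem_cellList, Function.comp,
      decide_eq_true_eq] at hd ⊢
    refine ⟨hd.1, ?_⟩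
    rw [hsub d hd.1 hd.2]
    exact hd.2

lemma key_iff_of_rk_eq {β γ : Type} [LinearOrder β] [LinearOrder γ] {μ : YoungDiagram}
    {f : ℕ × ℕ → β} {g : ℕ × ℕ → γ} (h : rk μ f = rk μ g) :
    ∀ c ∈ μ.cells, ∀ d ∈ μ.cells, (f c ≤ f d ↔ g c ≤ g d) := by
  intro c hc d hd
  rw [← rk_le μ f hc hd, h, rk_le μ g hc hd]

lemma std_injOn (μ : YoungDiagram) (w : Equiv.Perm ℕ) :
    Set.InjOn (fun T => rk μ (key T)) (EGset μ w) := by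
  intro T hT T' hT' h
  have hk := key_iff_of_rk_eq h
  by_contra hne
  have hex : (μ.cells.filter fun c => T c.1 c.2 ≠ T' c.1 c.2).Nonempty := by
    by_contra hemp
    apply hne
    ext i j
    by_cases hc : (i, j) ∈ μ.cells
    · by_contra hij
      exact hemp ⟨(i, j), by rw [Finset.mem_filter]; exact ⟨hc, hij⟩⟩
    · rw [hT.2.2.1 i j hc, hT'.2.2.1 i j hc]
  obtain ⟨c0, hc0, hmin⟩ := Finset.exists_min_image _ (key T) hex
  rw [Finset.mem_filter] at hc0
  have hm : ∀ d ∈ μ.cells, ¬ key T c0 ≤ key T d → T d.1 d.2 = T' d.1 d.2 := by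
    intro d hd hn
    by_contra hne
    exact hn (hmin d (Finset.mem_filter.2 ⟨hd, hne⟩))
  rcases lt_or_gt_of_ne hc0.2 with hlt | hlt
  · exact inj_aux hT hT' hk c0 hc0.1 hlt hm
  · refine inj_aux hT' hT (fun c hc d hd => (hk c hc d hd).symm) c0 hc0.1 hlt ?_
    intro d hd hn
    rw [← hk c0 hc0.1 d hd] at hn
    exact (hm d hd hn).symm

/-- Key of the row superstandard tableau. -/
def rowKey (c : ℕ × ℕ) : ℕ ×ₗ ℕ := toLex c

lemma rowKey_le (c d : ℕ × ℕ) : rowKey c ≤ rowKey d ↔ c.1 < d.1 ∨ c.1 = d.1 ∧ c.2 ≤ d.2 := by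
  simp only [rowKey, Prod.Lex.toLex_le_toLex]

end EGAux

open EGAux
theorem stmt15 (w : Equiv.Perm ℕ) (l : List ℕ) (hl : IsReducedWord w l)
    (hsupp : l.toFinset.card < l.length)
    (μ : YoungDiagram) (hμ : μ.card = l.length) :
    (EGset μ w).ncard < (SYTset μ).ncard := by
  have hrowmem : rk μ rowKey ∈ SYTset μ := by
    apply rk_mem
    · exact fun c d h => h
    · intro i j1 j2 h _
      rw [← not_le, rowKey_le]
      simp
      omega
    · intro i1 i2 j h _
      rw [← not_le, rowKey_le]
      simp
      omega
  rw [← Set.InjOn.ncard_image (std_injOn μ w)]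
  refine Set.ncard_lt_ncard ?_ (finite_SYT μ)
  rw [Set.ssubset_iff_of_subset]
  · refine ⟨rk μ rowKey, hrowmem, ?_⟩
    rintro ⟨T, hT, hTr⟩
    have hk := key_iff_of_rk_eq hTr
    have hinj : ∀ c ∈ μ.cells, ∀ d ∈ μ.cells, rowKey c ≤ rowKey d → T c.1 c.2 = T d.1 d.2 →
        c = d := by
      intro c hc d hd hcd he
      have h1 := (key_le _ _ _).1 ((hk c hc d hd).2 hcd)
      have h2 := (rowKey_le c d).1 hcd
      have h3 : ¬ c.1 < d.1 := by
        intro h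
        have := row_le hT hd h (by omega)
        omega
      have h4 : ¬ c.2 < d.2 := by
        intro h
        have e : c.1 = d.1 := by omega
        have := hT.1 d.1 c.2 d.2 h hd
        rw [e] at he
        omega
      ext <;> omega
    have hnd : (readingWord μ T).Nodup := by
      rw [readingWord_eq]
      refine List.Nodup.map_on ?_ (nodup_cellList μ)
      intro c hc d hd he
      rw [mem_cellList] at hc hd
      rcases le_total (rowKey c) (rowKey d) with h | h
      · exact hinj c hc d hd h he
      · exact (hinj d hd c hc h he.symm).symm
    have hsub := mem_of_nodup (readingWord μ T) l hnd (hT.2.2.2.1.trans hl.1.symm)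
    have hcard : (readingWord μ T).toFinset.card ≤ l.toFinset.card := by
      apply Finset.card_le_card
      intro c hc
      exact List.mem_toFinset.2 (hsub c (List.mem_toFinset.1 hc))
    rw [List.toFinset_card_of_nodup hnd, hT.2.2.2.2, ← hl.2] at hcard
    omega
  · rintro _ ⟨T, hT, rfl⟩
    apply rk_mem
    · exact key_inj T
    · intro i j1 j2 h h2
      exact key_lt _ _ _ (hT.1 i j1 j2 h h2)
    · intro i1 i2 j h h2
      exact key_lt _ _ _ (hT.2.1 i1 i2 j h h2)
end

section
/- Let λ be a partition with at least two rows and at least two columns, and let w ∈ S_∞. Then w is λ-maximal (a_{w,λ} = f^λ) if and only if ℓ(w) = |λ| and w is totally commutative. -/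
open Equiv

/-! ### Words in the simple transpositions -/

/-- The product of a word. -/
def EGP (l : List ℕ) : Equiv.Perm ℕ := (l.map EGs).prod

/-- A word of minimal length for its product. -/
def EGRed (l : List ℕ) : Prop := ∀ l', EGP l' = EGP l → l.length ≤ l'.length

theorem EGP_nil : EGP [] = 1 := rfl
theorem EGP_cons (x : ℕ) (l : List ℕ) : EGP (x :: l) = EGs x * EGP l := by simp [EGP]
theorem EGP_append (l l' : List ℕ) : EGP (l ++ l') = EGP l * EGP l' := by simp [EGP]

theorem EGs_apply (x y : ℕ) :
    EGs x y = if y = x then x + 1 else if y = x + 1 then x else y := by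
  simp [EGs, Equiv.swap_apply_def]

theorem EGRed_of_reduced {w : Equiv.Perm ℕ} {l : List ℕ} (h : IsReducedWord w l) : EGRed l := by
  intro l' hl'
  rw [h.2]
  exact Nat.sInf_le ⟨l', by rw [← h.1]; exact hl', rfl⟩

theorem EGRed_tail {x : ℕ} {l : List ℕ} (h : EGRed (x :: l)) : EGRed l := by
  intro l' hl'
  have := h (x :: l') (by rw [EGP_cons, EGP_cons, hl'])
  simpa using this

/-- The word `h, h+1, …, h+d-1`. -/
def cycw (h d : ℕ) : List ℕ := List.range' h d

theorem cycw_apply (d : ℕ) : ∀ h y : ℕ,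
    (y < h → EGP (cycw h d) y = y) ∧ (h ≤ y → y < h + d → EGP (cycw h d) y = y + 1) := by
  induction d with
  | zero => intro h y; simp [cycw, EGP]
  | succ d ih =>
    intro h y
    have e : cycw h (d+1) = h :: cycw (h+1) d := by simp [cycw, List.range'_succ]
    rw [e, EGP_cons]
    obtain ⟨h1, h2⟩ := ih (h+1) y
    constructor
    · intro hy
      rw [Equiv.Perm.mul_apply, h1 (by omega), EGs_apply]
      split_ifs <;> omega
    · intro hy hy'
      rw [Equiv.Perm.mul_apply]
      by_cases hyh : y = h
      · rw [h1 (by omega), EGs_apply]; simp [hyh]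
      · rw [h2 (by omega) (by omega), EGs_apply]
        split_ifs <;> omega

theorem cycw_cons (h d : ℕ) : EGs h * EGP (cycw (h+1) d) = EGP (cycw h (d+1)) := by
  rw [← EGP_cons]; simp [cycw, List.range'_succ]

theorem cycw_low (h d x : ℕ) (hx : x + 1 < h) :
    EGs x * EGP (cycw h d) = EGP (cycw h d) * EGs x := by
  unfold EGs
  rw [Equiv.mul_swap_eq_swap_mul, (cycw_apply d h x).1 (by omega),
    (cycw_apply d h (x+1)).1 (by omega)]

theorem cycw_high (h d x : ℕ) (hx : h < x) (hx' : x < h + d) :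
    EGs x * EGP (cycw h d) = EGP (cycw h d) * EGs (x-1) := by
  obtain ⟨y, rfl⟩ : ∃ y, x = y + 1 := ⟨x-1, by omega⟩
  unfold EGs
  simp only [Nat.add_sub_cancel]
  rw [Equiv.mul_swap_eq_swap_mul, (cycw_apply d h y).2 (by omega) (by omega),
    (cycw_apply d h (y+1)).2 (by omega) (by omega)]

theorem cycw_length (h d : ℕ) : (cycw h d).length = d := by simp [cycw]

/-- Delete the strand ending at height `M` from the wiring diagram of a word. -/
def delW (M : ℕ) : List ℕ → List ℕ
  | [] => []
  | x :: l => if x + 1 = EGP l M then delW M l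
      else (if EGP l M < x then x - 1 else x) :: delW M l

theorem delW_spec (M : ℕ) : ∀ l : List ℕ, EGRed l → (∀ x ∈ l, x < M) →
    EGP l M ≤ M ∧ EGP l = EGP (cycw (EGP l M) (M - EGP l M)) * EGP (delW M l) ∧
    (delW M l).length + (M - EGP l M) = l.length ∧ (∀ y ∈ delW M l, y + 1 < M) ∧
    (∀ x l', l = x :: l' → x ≠ EGP l' M) := by
  intro l
  induction l with
  | nil => intro _ _; simp [EGP, cycw, delW]
  | cons x l ih =>
    intro hr hM
    obtain ⟨i1, i2, i3, i4, -⟩ := ih (EGRed_tail hr) (fun y hy => hM y (by simp [hy]))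
    have hx : x < M := hM x (by simp)
    rw [EGP_cons, Equiv.Perm.mul_apply, delW]
    have hne : x ≠ EGP l M := by
      intro he
      generalize EGP l M = h at *
      subst he
      have hd : M - x = (M - (x+1)) + 1 := by omega
      have := hr (cycw (x+1) (M - (x+1)) ++ delW M l) (by
        rw [EGP_append, EGP_cons, i2, hd, ← cycw_cons, ← mul_assoc, ← mul_assoc]
        simp [EGs])
      simp [cycw_length] at this
      omega
    have hlast : ∀ x_1 l', x :: l = x_1 :: l' → x_1 ≠ EGP l' M := by
      rintro _ _ ⟨rfl, rfl⟩; exact hne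
    generalize EGP l M = h at *
    rw [EGs_apply]
    split_ifs with h1 h2 h3 h4 h5 <;> try omega
    · obtain rfl : h = x + 1 := by omega
      have hd : M - x = (M - (x+1)) + 1 := by omega
      refine ⟨by omega, ?_, by simp; omega, i4, hlast⟩
      rw [i2, hd, ← cycw_cons, mul_assoc]
    · refine ⟨i1, ?_, by simp; omega, ?_, hlast⟩
      · rw [i2, EGP_cons, ← mul_assoc, ← mul_assoc, cycw_high h (M-h) x (by omega) (by omega)]
      · intro y hy
        rcases List.mem_cons.1 hy with rfl | hy
        · omega
        · exact i4 y hy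
    · refine ⟨i1, ?_, by simp; omega, ?_, hlast⟩
      · rw [i2, EGP_cons, ← mul_assoc, ← mul_assoc, cycw_low _ _ _ (by omega)]
      · intro y hy
        rcases List.mem_cons.1 hy with rfl | hy
        · omega
        · exact i4 y hy

theorem delW_red (M : ℕ) (l : List ℕ) (hr : EGRed l) (hM : ∀ x ∈ l, x < M) :
    EGRed (delW M l) := by
  obtain ⟨i1, i2, i3, i4, -⟩ := delW_spec M l hr hM
  intro l' hl'
  have := hr (cycw (EGP l M) (M - EGP l M) ++ l') (by rw [EGP_append, hl', ← i2])
  simp [cycw_length] at this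
  omega

theorem EGstep (M x : ℕ) (l : List ℕ) (hr : EGRed (x :: l)) (hM : ∀ y ∈ x :: l, y < M) :
    (x + 1 = EGP l M ∧ EGP (x :: l) M = x) ∨
    (x ≠ EGP l M ∧ x + 1 ≠ EGP l M ∧ EGP (x :: l) M = EGP l M) := by
  have hne := (delW_spec M _ hr hM).2.2.2.2 x l rfl
  rw [EGP_cons, Equiv.Perm.mul_apply, EGs_apply]
  split_ifs with h1 h2 <;> omega

/-! ### The path of a strand is determined by the standardization -/

theorem path_mono (n : ℕ) (A ha : ℕ → ℕ)
    (sa : ∀ i < n, (A i + 1 = ha (i+1) ∧ ha i = A i) ∨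
      (A i ≠ ha (i+1) ∧ A i + 1 ≠ ha (i+1) ∧ ha i = ha (i+1))) :
    ∀ j ≤ n, ∀ i ≤ j, ha i ≤ ha j := by
  intro j
  induction j with
  | zero => intro _ i hi; obtain rfl : i = 0 := by omega
            exact le_rfl
  | succ j ih =>
    intro hj i hi
    rcases Nat.lt_or_ge j i with h | h
    · obtain rfl : i = j + 1 := by omega
      exact le_rfl
    · have := ih (by omega) i h
      rcases sa j (by omega) with h | h <;> omega

/-- The path passes through every intermediate height. -/
theorem path_ivt (n : ℕ) (A ha : ℕ → ℕ)
    (sa : ∀ i < n, (A i + 1 = ha (i+1) ∧ ha i = A i) ∨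
      (A i ≠ ha (i+1) ∧ A i + 1 ≠ ha (i+1) ∧ ha i = ha (i+1)))
    (x : ℕ) : ∀ d i j, i + d = j → j ≤ n → ha i ≤ x → x < ha j →
      ∃ k, i ≤ k ∧ k < j ∧ A k = x ∧ ha k = x := by
  intro d
  induction d with
  | zero => intro i j hij _ h1 h2; subst hij; simp at h2; omega
  | succ d ih =>
    intro i j hij hj h1 h2
    by_cases hx : x < ha (i+d)
    · obtain ⟨k, a, b, c⟩ := ih i (i+d) rfl (by omega) h1 hx
      exact ⟨k, a, by omega, c⟩
    · subst hij
      refine ⟨i+d, by omega, by omega, ?_⟩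
      have := sa (i+d) (by omega)
      rw [show i + (d+1) = i + d + 1 by omega] at h2
      omega

/-- No two different paths: the descent step. -/
theorem path_descent (n : ℕ) (A B ha hb : ℕ → ℕ)
    (sa : ∀ i < n, (A i + 1 = ha (i+1) ∧ ha i = A i) ∨
      (A i ≠ ha (i+1) ∧ A i + 1 ≠ ha (i+1) ∧ ha i = ha (i+1)))
    (sb : ∀ i < n, (B i + 1 = hb (i+1) ∧ hb i = B i) ∨
      (B i ≠ hb (i+1) ∧ B i + 1 ≠ hb (i+1) ∧ hb i = hb (i+1)))
    (h0 : ha 0 = hb 0)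
    (hs : ∀ i j, i < j → j < n → (A i < A j ↔ B i < B j)) :
    ∀ x i j, i < j → j < n → A i = x → B i = x → A j < x → B j = x → ha i = x → hb j = x →
      False := by
  intro x
  induction x with
  | zero => intro i j _ _ _ _ h _ _ _; omega
  | succ x ih =>
    intro i j hij hj ai bi aj bj hai hbj
    have m1 : hb (i+1) ≤ hb j := path_mono n B hb sb j (by omega) (i+1) (by omega)
    have m2 : hb (i+1) ≤ x := by
      have := sb i (by omega)
      omega
    obtain ⟨r', r1, r2, r3, r4⟩ := path_ivt n B hb sb x (j-(i+1)) (i+1) j (by omega) (by omega)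
      m2 (by omega)
    have m3 : hb 0 ≤ hb (i+1) := path_mono n B hb sb (i+1) (by omega) 0 (by omega)
    obtain ⟨r, q1, q2, q3, q4⟩ := path_ivt n A ha sa x i 0 i (by omega) (by omega)
      (by omega) (by omega)
    have e1 := hs r' j (by omega) hj
    have e2 := hs r i (by omega) (by omega)
    have e3 := hs r r' (by omega) (by omega)
    exact ih r r' (by omega) (by omega) q3 (by omega) (by omega) r3 q4 r4

theorem path_eq (n M : ℕ) (A B ha hb : ℕ → ℕ)
    (sa : ∀ i < n, (A i + 1 = ha (i+1) ∧ ha i = A i) ∨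
      (A i ≠ ha (i+1) ∧ A i + 1 ≠ ha (i+1) ∧ ha i = ha (i+1)))
    (sb : ∀ i < n, (B i + 1 = hb (i+1) ∧ hb i = B i) ∨
      (B i ≠ hb (i+1) ∧ B i + 1 ≠ hb (i+1) ∧ hb i = hb (i+1)))
    (h0 : ha 0 = hb 0) (han : ha n = M) (hbn : hb n = M)
    (hA : ∀ i < n, A i < M) (hB : ∀ i < n, B i < M)
    (hs : ∀ i j, i < j → j < n → (A i < A j ↔ B i < B j)) :
    ∀ d i, i + d = n → ha i = hb i ∧ ∀ q < i, ∀ h' ≥ ha i, (A q < h' ↔ B q < h') := by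
  have key : ∀ (A B ha hb : ℕ → ℕ)
    (_ : ∀ i < n, (A i + 1 = ha (i+1) ∧ ha i = A i) ∨
      (A i ≠ ha (i+1) ∧ A i + 1 ≠ ha (i+1) ∧ ha i = ha (i+1)))
    (_ : ∀ i < n, (B i + 1 = hb (i+1) ∧ hb i = B i) ∨
      (B i ≠ hb (i+1) ∧ B i + 1 ≠ hb (i+1) ∧ hb i = hb (i+1)))
    (_ : ha 0 = hb 0)
    (_ : ∀ i j, i < j → j < n → (A i < A j ↔ B i < B j)),
    ∀ i < n, ha (i+1) = hb (i+1) → (∀ q < i+1, ∀ h' ≥ ha (i+1), (A q < h' ↔ B q < h')) →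
      B i + 1 = hb (i+1) → A i + 1 = ha (i+1) := by
    intro A B ha hb sa sb h0 hs i hi he hq hB
    by_contra hA
    have a1 := sa i hi
    have b1 := sb i hi
    have c1 := hq i (by omega) (ha (i+1)) le_rfl
    have m := path_mono n B hb sb i (by omega) 0 (by omega)
    obtain ⟨q, q1, q2, q3, q4⟩ := path_ivt n A ha sa (B i) i 0 i (by omega) (by omega)
      (by omega) (by omega)
    have c2 := hq q (by omega) (ha (i+1)) le_rfl
    have c3 := hs q i (by omega) (by omega)
    exact path_descent n A B ha hb sa sb h0 hs (B i) q i (by omega) hi q3 (by omega) (by omega)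
      rfl q4 (by omega)
  intro d
  induction d with
  | zero =>
    intro i hi
    obtain rfl : i = n := by omega
    refine ⟨by omega, fun q hq h' hh => ?_⟩
    have := hA q hq
    have := hB q hq
    omega
  | succ d ih =>
    intro i hi
    obtain ⟨e, hq⟩ := ih (i+1) (by omega)
    have k1 := key A B ha hb sa sb h0 hs i (by omega) e hq
    have k2 := key B A hb ha sb sa h0.symm (fun i j a b => (hs i j a b).symm) i (by omega) e.symm
      (fun q hq1 h' hh => (hq q hq1 h' (by omega)).symm)
    have a1 := sa i (by omega)
    have b1 := sb i (by omega)
    refine ⟨by omega, fun q hq1 h' hh => ?_⟩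
    by_cases hh' : ha (i+1) ≤ h'
    · exact hq q (by omega) h' hh'
    · have : h' = A i ∧ h' = B i := by omega
      have := hs q i (by omega) (by omega)
      omega

/-! ### A reduced word is determined by its product and its standardization -/

theorem EGRed_drop {l : List ℕ} (h : EGRed l) (i : ℕ) : EGRed (l.drop i) := by
  intro l' hl'
  have := h (l.take i ++ l') (by
    rw [EGP_append, hl', ← EGP_append, List.take_append_drop])
  have h2 := congrArg List.length (List.take_append_drop i l)
  simp only [List.length_append] at this h2
  omega

/-- Two words (given as a list of pairs) having the same strand path. -/
def GoodP (M : ℕ) : List (ℕ × ℕ) → Prop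
  | [] => True
  | p :: l => EGP (l.map Prod.fst) M = EGP (l.map Prod.snd) M ∧
      (∀ h' ≥ EGP (l.map Prod.fst) M, (p.1 < h' ↔ p.2 < h')) ∧
      (p.1 + 1 = EGP (l.map Prod.fst) M ↔ p.2 + 1 = EGP (l.map Prod.fst) M) ∧
      p.1 ≠ EGP (l.map Prod.fst) M ∧ p.2 ≠ EGP (l.map Prod.fst) M ∧
      (EGP ((p :: l).map Prod.fst) M =
        if p.1 + 1 = EGP (l.map Prod.fst) M then p.1 else EGP (l.map Prod.fst) M) ∧
      GoodP M l

/-- Simultaneous deletion of the strand. -/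
def delP (M : ℕ) : List (ℕ × ℕ) → List (ℕ × ℕ)
  | [] => []
  | p :: l => if p.1 + 1 = EGP (l.map Prod.fst) M then delP M l
      else (if EGP (l.map Prod.fst) M < p.1 then p.1 - 1 else p.1,
        if EGP (l.map Prod.fst) M < p.2 then p.2 - 1 else p.2) :: delP M l

theorem delP_fst (M : ℕ) (l : List (ℕ × ℕ)) :
    (delP M l).map Prod.fst = delW M (l.map Prod.fst) := by
  induction l with
  | nil => rfl
  | cons p l ih =>
    simp only [delP, List.map_cons, delW]
    by_cases h1 : p.1 + 1 = EGP (l.map Prod.fst) M <;> simp [h1, ih]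

theorem delP_snd (M : ℕ) (l : List (ℕ × ℕ)) (hg : GoodP M l) :
    (delP M l).map Prod.snd = delW M (l.map Prod.snd) := by
  induction l with
  | nil => rfl
  | cons p l ih =>
    obtain ⟨g1, g2, g3, g4, g5, g6, g7⟩ := hg
    simp only [delP, List.map_cons, delW, ← g1]
    by_cases h1 : p.1 + 1 = EGP (l.map Prod.fst) M
    · simp [h1, g3.1 h1, ih g7]
    · have h2 : ¬ p.2 + 1 = EGP (l.map Prod.fst) M := fun h => h1 (g3.2 h)
      simp [h1, h2, ih g7]

theorem GoodP_low (M : ℕ) (l : List (ℕ × ℕ)) (hg : GoodP M l)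
    (hp : l.Pairwise fun x y => (x.1 < y.1 ↔ x.2 < y.2)) :
    ∀ y ∈ l, ∀ v ≥ EGP (l.map Prod.fst) M, (v < y.1 ↔ v < y.2) := by
  induction l with
  | nil => simp
  | cons p l ih =>
    obtain ⟨g1, g2, g3, g4, g5, g6, g7⟩ := hg
    rw [List.pairwise_cons] at hp
    intro y hy v hv
    rw [g6] at hv
    have hh := g2 _ le_rfl
    rcases List.mem_cons.1 hy with rfl | hy
    · have h1 := g2 v
      have h2 := g2 (v+1)
      split_ifs at hv with h3
      · have := g3.1 h3
        omega
      · omega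
    · have := ih g7 hp.2 y hy v
      split_ifs at hv with h3
      · have h4 := g3.1 h3
        have h5 := hp.1 y hy
        by_cases h6 : v = p.1
        · have : p.1 = p.2 := by omega
          omega
        · exact this (by omega)
      · exact this hv

theorem delP_mem (M : ℕ) (l : List (ℕ × ℕ)) (hg : GoodP M l) :
    ∀ y' ∈ delP M l, ∃ y ∈ l, y' = y ∨ (EGP (l.map Prod.fst) M < y.1 ∧
      EGP (l.map Prod.fst) M < y.2 ∧ y' = (y.1 - 1, y.2 - 1)) := by
  induction l with
  | nil => simp [delP]
  | cons p l ih =>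
    obtain ⟨g1, g2, g3, g4, g5, g6, g7⟩ := hg
    intro y' hy'
    have hle : EGP ((p :: l).map Prod.fst) M ≤ EGP (l.map Prod.fst) M := by
      rw [g6]; split_ifs <;> omega
    have old : y' ∈ delP M l → ∃ y ∈ p :: l, y' = y ∨ (EGP ((p :: l).map Prod.fst) M < y.1 ∧
      EGP ((p :: l).map Prod.fst) M < y.2 ∧ y' = (y.1 - 1, y.2 - 1)) := by
      intro h
      obtain ⟨y, hy, h⟩ := ih g7 y' h
      refine ⟨y, by simp [hy], ?_⟩
      rcases h with h | ⟨a, b, c⟩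
      · exact Or.inl h
      · exact Or.inr ⟨by omega, by omega, c⟩
    rw [delP] at hy'
    by_cases h1 : p.1 + 1 = EGP (l.map Prod.fst) M
    · rw [if_pos h1] at hy'
      exact old hy'
    · rw [if_neg h1] at hy'
      rcases List.mem_cons.1 hy' with h | h
      · refine ⟨p, by simp, ?_⟩
        have := g2 _ le_rfl
        by_cases h2 : EGP (l.map Prod.fst) M < p.1
        · right
          have h3 : EGP (l.map Prod.fst) M < p.2 := by omega
          refine ⟨by omega, by omega, ?_⟩
          rw [h, if_pos h2, if_pos h3]
        · left
          have h3 : ¬ EGP (l.map Prod.fst) M < p.2 := by omega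
          rw [h, if_neg h2, if_neg h3]
      · exact old h

theorem delP_pairwise (M : ℕ) (l : List (ℕ × ℕ)) (hg : GoodP M l)
    (hp : l.Pairwise fun x y => (x.1 < y.1 ↔ x.2 < y.2)) :
    (delP M l).Pairwise fun x y => (x.1 < y.1 ↔ x.2 < y.2) := by
  induction l with
  | nil => simp [delP]
  | cons p l ih =>
    obtain ⟨g1, g2, g3, g4, g5, g6, g7⟩ := hg
    rw [List.pairwise_cons] at hp
    have ih := ih g7 hp.2
    rw [delP]
    split_ifs with h1 h2 h3 h4
    all_goals try exact ih
    all_goals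
      have h0 := g2 _ le_rfl
      have h6 := mt g3.2 h1
      rw [List.pairwise_cons]
      refine ⟨?_, ih⟩
      intro y' hy'
      obtain ⟨y, hy, h⟩ := delP_mem M l g7 y' hy'
      have k1 := hp.1 y hy
      have k2 := GoodP_low M l g7 hp.2 y hy
      have e1 := g2 p.1
      have e2 := g2 (p.1 + 1)
      have k3 := k2 (p.1 - 1)
      rcases h with rfl | ⟨a, b, rfl⟩
      · dsimp only
        omega
      · dsimp only
        omega

theorem delP_eq (M : ℕ) (l : List (ℕ × ℕ)) (hg : GoodP M l)
    (hd : ∀ p ∈ delP M l, p.1 = p.2) : ∀ p ∈ l, p.1 = p.2 := by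
  induction l with
  | nil => simp
  | cons p l ih =>
    obtain ⟨g1, g2, g3, g4, g5, g6, g7⟩ := hg
    have h0 := g2 _ le_rfl
    rw [delP] at hd
    intro y hy
    by_cases h1 : p.1 + 1 = EGP (l.map Prod.fst) M
    · rw [if_pos h1] at hd
      rcases List.mem_cons.1 hy with rfl | hy
      · have := g3.1 h1
        omega
      · exact ih g7 hd y hy
    · rw [if_neg h1] at hd
      rcases List.mem_cons.1 hy with rfl | hy
      · have := hd _ (List.mem_cons_self)
        dsimp only at this
        split_ifs at this <;> omega
      · exact ih g7 (fun p hp => hd p (List.mem_cons_of_mem _ hp)) y hy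

theorem GoodP_of (M : ℕ) (l : List (ℕ × ℕ)) (hM : ∀ p ∈ l, p.1 < M ∧ p.2 < M)
    (r1 : EGRed (l.map Prod.fst)) (r2 : EGRed (l.map Prod.snd))
    (he : EGP (l.map Prod.fst) = EGP (l.map Prod.snd))
    (hp : l.Pairwise fun x y => (x.1 < y.1 ↔ x.2 < y.2)) : GoodP M l := by
  set A : ℕ → ℕ := fun i => (l.getD i (0,0)).1 with hA
  set B : ℕ → ℕ := fun i => (l.getD i (0,0)).2 with hB
  set ha : ℕ → ℕ := fun i => EGP ((l.drop i).map Prod.fst) M with hha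
  set hb : ℕ → ℕ := fun i => EGP ((l.drop i).map Prod.snd) M with hhb
  have hget : ∀ i (hi : i < l.length), l.getD i (0,0) = l[i] := by
    intro i hi; simp [hi]
  have sa : ∀ i < l.length, (A i + 1 = ha (i+1) ∧ ha i = A i) ∨
      (A i ≠ ha (i+1) ∧ A i + 1 ≠ ha (i+1) ∧ ha i = ha (i+1)) := by
    intro i hi
    have e : (l.drop i).map Prod.fst = A i :: (l.drop (i+1)).map Prod.fst := by
      rw [List.drop_eq_getElem_cons hi, List.map_cons, hA]; simp only [hget i hi]
    have := EGstep M (A i) ((l.drop (i+1)).map Prod.fst)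
      (by rw [← e, List.map_drop]; exact EGRed_drop r1 i) (by
        rw [← e]; intro y hy
        obtain ⟨z, hz, rfl⟩ := List.mem_map.1 hy
        exact (hM z (List.mem_of_mem_drop hz)).1)
    rw [← e] at this
    exact this
  have sb : ∀ i < l.length, (B i + 1 = hb (i+1) ∧ hb i = B i) ∨
      (B i ≠ hb (i+1) ∧ B i + 1 ≠ hb (i+1) ∧ hb i = hb (i+1)) := by
    intro i hi
    have e : (l.drop i).map Prod.snd = B i :: (l.drop (i+1)).map Prod.snd := by
      rw [List.drop_eq_getElem_cons hi, List.map_cons, hB]; simp only [hget i hi]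
    have := EGstep M (B i) ((l.drop (i+1)).map Prod.snd)
      (by rw [← e, List.map_drop]; exact EGRed_drop r2 i) (by
        rw [← e]; intro y hy
        obtain ⟨z, hz, rfl⟩ := List.mem_map.1 hy
        exact (hM z (List.mem_of_mem_drop hz)).2)
    rw [← e] at this
    exact this
  have main := path_eq l.length M A B ha hb sa sb (by simp [hha, hhb, he]) (by simp only [hha, List.drop_length, List.map_nil]; rfl)
    (by simp only [hhb, List.drop_length, List.map_nil]; rfl)
    (fun i hi => by simp only [hA, hget i hi]; exact (hM _ (List.getElem_mem hi)).1)
    (fun i hi => by simp only [hB, hget i hi]; exact (hM _ (List.getElem_mem hi)).2)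
    (fun i j hij hj => by
      simp only [hA, hB, hget i (by omega), hget j hj]
      exact List.pairwise_iff_getElem.1 hp i j (by omega) hj hij)
  have fin : ∀ d i, i + d = l.length → GoodP M (l.drop i) := by
    intro d
    induction d with
    | zero => intro i hi; rw [List.drop_eq_nil_of_le (by omega)]; trivial
    | succ d ih =>
      intro i hi
      have hi' : i < l.length := by omega
      obtain ⟨m1, m2⟩ := main d (i+1) (by omega)
      obtain ⟨n1, -⟩ := main (d+1) i hi
      have a1 := sa i hi'
      have b1 := sb i hi'
      have e1 : l[i].1 = A i := by simp only [hA, hget i hi']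
      have e2 : l[i].2 = B i := by simp only [hB, hget i hi']
      have hi2 : ha i = EGP ((l[i] :: l.drop (i+1)).map Prod.fst) M := by
        rw [← List.drop_eq_getElem_cons hi']
      rw [List.drop_eq_getElem_cons hi']
      refine ⟨m1, ?_, ?_, ?_, ?_, ?_, ih (i+1) (by omega)⟩
      · rw [e1, e2]; exact m2 i (by omega)
      · rw [e1, e2]
        change A i + 1 = ha (i+1) ↔ B i + 1 = ha (i+1)
        omega
      · rw [e1]
        change A i ≠ ha (i+1)
        omega
      · rw [e2]
        change B i ≠ ha (i+1)
        omega
      · rw [← hi2, e1]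
        change ha i = if A i + 1 = ha (i+1) then A i else ha (i+1)
        split_ifs <;> omega
  simpa using fin l.length 0 (by omega)

theorem std_inj : ∀ (M : ℕ) (l : List (ℕ × ℕ)), (∀ p ∈ l, p.1 < M ∧ p.2 < M) →
    EGRed (l.map Prod.fst) → EGRed (l.map Prod.snd) →
    EGP (l.map Prod.fst) = EGP (l.map Prod.snd) →
    (l.Pairwise fun x y => (x.1 < y.1 ↔ x.2 < y.2)) → ∀ p ∈ l, p.1 = p.2 := by
  intro M
  induction M with
  | zero => intro l hM _ _ _ _ p hp; have := hM p hp; omega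
  | succ M ih =>
    intro l hM r1 r2 he hp
    have hg := GoodP_of (M+1) l hM r1 r2 he hp
    have m1 : ∀ x ∈ l.map Prod.fst, x < M + 1 := by
      intro y hy
      obtain ⟨z, hz, rfl⟩ := List.mem_map.1 hy
      exact (hM z hz).1
    have m2 : ∀ x ∈ l.map Prod.snd, x < M + 1 := by
      intro y hy
      obtain ⟨z, hz, rfl⟩ := List.mem_map.1 hy
      exact (hM z hz).2
    have s1 := delW_spec (M+1) _ r1 m1
    have s2 := delW_spec (M+1) _ r2 m2
    apply delP_eq (M+1) l hg
    have f1 := delP_fst (M+1) l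
    have f2 := delP_snd (M+1) l hg
    apply ih
    · intro p hp
      have a1 := s1.2.2.2.1 p.1 (by rw [← f1]; exact List.mem_map_of_mem hp)
      have a2 := s2.2.2.2.1 p.2 (by rw [← f2]; exact List.mem_map_of_mem hp)
      omega
    · rw [f1]; exact delW_red _ _ r1 m1
    · rw [f2]; exact delW_red _ _ r2 m2
    · rw [f1, f2]
      have e1 := s1.2.1
      have e2 := s2.2.1
      rw [← he] at e2
      exact mul_left_cancel (e1.symm.trans e2)
    · exact delP_pairwise _ _ hg hp

/-! ### Cells in reading order, ranks and standard tableaux -/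

/-- The cells of `μ` in reading order. -/
def cellsList (μ : YoungDiagram) : List (ℕ × ℕ) :=
  (List.range (μ.colLen 0)).flatMap fun i =>
    ((List.range (μ.rowLen i)).reverse).map fun j => (i, j)

/-- The reading order. -/
def RO (c d : ℕ × ℕ) : Prop := c.1 < d.1 ∨ (c.1 = d.1 ∧ d.2 < c.2)

theorem readingWord_eq (μ : YoungDiagram) (T : ℕ → ℕ → ℕ) :
    readingWord μ T = (cellsList μ).map fun c => T c.1 c.2 := by
  simp [readingWord, cellsList, List.map_flatMap, Function.comp_def]

theorem mem_cellsList {μ : YoungDiagram} {c : ℕ × ℕ} : c ∈ cellsList μ ↔ c ∈ μ.cells := by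
  obtain ⟨i, j⟩ := c
  rw [YoungDiagram.mem_cells, YoungDiagram.mem_iff_lt_rowLen]
  simp only [cellsList, List.mem_flatMap, List.mem_range, List.mem_map, List.mem_reverse,
    Prod.mk.injEq]
  constructor
  · rintro ⟨a, ha, b, hb, rfl, rfl⟩
    exact hb
  · intro h
    refine ⟨i, ?_, j, h, rfl, rfl⟩
    rw [← YoungDiagram.mem_iff_lt_colLen]
    rw [← YoungDiagram.mem_iff_lt_rowLen] at h
    exact μ.up_left_mem le_rfl (Nat.zero_le _) h

theorem cellsList_pairwise (μ : YoungDiagram) : (cellsList μ).Pairwise RO := by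
  rw [cellsList, List.pairwise_flatMap]
  constructor
  · intro i _
    rw [List.pairwise_map, List.pairwise_reverse]
    exact List.pairwise_lt_range.imp (fun h => Or.inr ⟨rfl, h⟩)
  · refine List.pairwise_lt_range.imp ?_
    intro a b hab x hx y hy
    obtain ⟨_, _, rfl⟩ := List.mem_map.1 hx
    obtain ⟨_, _, rfl⟩ := List.mem_map.1 hy
    exact Or.inl hab

theorem RO_irrefl (c : ℕ × ℕ) : ¬ RO c c := by simp [RO]
theorem RO_asymm {c d : ℕ × ℕ} (h : RO c d) : ¬ RO d c := by
  unfold RO at *; omega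
theorem RO_total {c d : ℕ × ℕ} (h : c ≠ d) : RO c d ∨ RO d c := by
  by_contra hh
  apply h
  unfold RO at hh
  ext <;> omega

theorem cellsList_nodup (μ : YoungDiagram) : (cellsList μ).Nodup :=
  (cellsList_pairwise μ).imp (fun {a b} h => by rintro rfl; exact RO_irrefl _ h)

theorem cellsList_toFinset (μ : YoungDiagram) : (cellsList μ).toFinset = μ.cells := by
  ext c; rw [List.mem_toFinset, mem_cellsList]

theorem cellsList_length (μ : YoungDiagram) : (cellsList μ).length = μ.card := by
  rw [← List.toFinset_card_of_nodup (cellsList_nodup μ), cellsList_toFinset]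

theorem mem_le {μ : YoungDiagram} {i i' j j' : ℕ} (h : (i', j') ∈ μ.cells) (hi : i ≤ i')
    (hj : j ≤ j') : (i, j) ∈ μ.cells := μ.up_left_mem hi hj h

theorem SYT_of {μ : YoungDiagram} {T : ℕ → ℕ → ℕ}
    (h1 : ∀ i j1 j2, j1 < j2 → (i, j2) ∈ μ.cells → T i j1 < T i j2)
    (h2 : ∀ i1 i2 j, i1 < i2 → (i2, j) ∈ μ.cells → T i1 j < T i2 j)
    (h3 : ∀ i j, (i, j) ∉ μ.cells → T i j = 0)
    (h4 : ∀ c ∈ μ.cells, 1 ≤ T c.1 c.2 ∧ T c.1 c.2 ≤ μ.card)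
    (h5 : ∀ c ∈ μ.cells, ∀ d ∈ μ.cells, T c.1 c.2 = T d.1 d.2 → c = d) : T ∈ SYTset μ := by
  refine ⟨h1, h2, h3, ?_⟩
  apply Finset.eq_of_subset_of_card_le
  · intro x hx
    obtain ⟨c, hc, rfl⟩ := Finset.mem_image.1 hx
    exact Finset.mem_Icc.2 (h4 c hc)
  · rw [Finset.card_image_of_injOn (fun c hc d hd h => h5 c hc d hd h)]
    simp

theorem SYT_inj {μ : YoungDiagram} {U : ℕ → ℕ → ℕ} (hU : U ∈ SYTset μ) :
    ∀ c ∈ μ.cells, ∀ d ∈ μ.cells, U c.1 c.2 = U d.1 d.2 → c = d := by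
  have := Finset.card_image_iff (s := μ.cells) (f := fun c : ℕ × ℕ => U c.1 c.2)
  rw [hU.2.2.2] at this
  intro c hc d hd h
  exact this.1 (by simp) hc hd h

theorem SYT_bd {μ : YoungDiagram} {U : ℕ → ℕ → ℕ} (hU : U ∈ SYTset μ) :
    ∀ c ∈ μ.cells, 1 ≤ U c.1 c.2 ∧ U c.1 c.2 ≤ μ.card := by
  intro c hc
  rw [← Finset.mem_Icc, ← hU.2.2.2]
  exact Finset.mem_image_of_mem (fun c : ℕ × ℕ => U c.1 c.2) hc

theorem SYT_surj {μ : YoungDiagram} {U : ℕ → ℕ → ℕ} (hU : U ∈ SYTset μ) (k : ℕ)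
    (h1 : 1 ≤ k) (h2 : k ≤ μ.card) : ∃ c ∈ μ.cells, U c.1 c.2 = k := by
  have : k ∈ Finset.Icc 1 μ.card := Finset.mem_Icc.2 ⟨h1, h2⟩
  rw [← hU.2.2.2] at this
  simpa using this

theorem SYT_finite (μ : YoungDiagram) : (SYTset μ).Finite := by
  apply Set.Finite.of_injOn (f := fun (U : ℕ → ℕ → ℕ) (c : μ.cells) =>
    (Fin.ofNat (μ.card + 1) (U c.1.1 c.1.2))) (t := Set.univ) (fun _ _ => trivial) _ Set.finite_univ
  intro U hU V hV h
  funext i j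
  by_cases hc : (i, j) ∈ μ.cells
  · have := congrArg Fin.val (congrFun h ⟨(i, j), hc⟩)
    have a := SYT_bd hU _ hc
    have b := SYT_bd hV _ hc
    simp only [Fin.ofNat] at this
    dsimp only at a b
    rwa [Nat.mod_eq_of_lt (by omega), Nat.mod_eq_of_lt (by omega)] at this
  · rw [hU.2.2.1 i j hc, hV.2.2.1 i j hc]

/-- The rank filling of a key function. -/
def rankT {α : Type} [LinearOrder α] (μ : YoungDiagram) (K : ℕ × ℕ → α) (i j : ℕ) : ℕ :=
  if (i, j) ∈ μ.cells then (μ.cells.filter fun c => K c ≤ K (i, j)).card else 0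

theorem rankT_lt {α : Type} [LinearOrder α] {μ : YoungDiagram} {K : ℕ × ℕ → α} {c d : ℕ × ℕ}
    (hc : c ∈ μ.cells) (hd : d ∈ μ.cells) : rankT μ K c.1 c.2 < rankT μ K d.1 d.2 ↔ K c < K d := by
  have mono : ∀ c ∈ μ.cells, ∀ d ∈ μ.cells, K c ≤ K d →
      rankT μ K c.1 c.2 ≤ rankT μ K d.1 d.2 := by
    intro c hc d hd h
    simp only [rankT, hc, hd, if_true]
    apply Finset.card_le_card
    intro x hx
    rw [Finset.mem_filter] at *
    exact ⟨hx.1, hx.2.trans h⟩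
  constructor
  · intro h
    by_contra hh
    have := mono d hd c hc (not_lt.1 hh)
    omega
  · intro h
    simp only [rankT, hc, hd, if_true]
    apply Finset.card_lt_card
    rw [Finset.ssubset_iff_of_subset]
    · refine ⟨d, by simp [hd], by simp [h]⟩
    · intro x hx
      rw [Finset.mem_filter] at *
      exact ⟨hx.1, hx.2.trans h.le⟩

theorem rankT_SYT {α : Type} [LinearOrder α] {μ : YoungDiagram} {K : ℕ × ℕ → α}
    (h1 : ∀ i j1 j2, j1 < j2 → (i, j2) ∈ μ.cells → K (i, j1) < K (i, j2))
    (h2 : ∀ i1 i2 j, i1 < i2 → (i2, j) ∈ μ.cells → K (i1, j) < K (i2, j))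
    (h3 : ∀ c ∈ μ.cells, ∀ d ∈ μ.cells, K c = K d → c = d) : rankT μ K ∈ SYTset μ := by
  apply SYT_of
  · intro i j1 j2 h hc
    exact (rankT_lt (mem_le hc le_rfl h.le) hc).2 (h1 i j1 j2 h hc)
  · intro i1 i2 j h hc
    exact (rankT_lt (mem_le hc h.le le_rfl) hc).2 (h2 i1 i2 j h hc)
  · intro i j h
    simp [rankT, h]
  · intro c hc
    simp only [rankT, hc, if_true]
    constructor
    · exact Finset.card_pos.2 ⟨c, by simp [hc]⟩
    · exact Finset.card_filter_le _ _
  · intro c hc d hd h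
    apply h3 c hc d hd
    have a := rankT_lt (K := K) hc hd
    have b := rankT_lt (K := K) hd hc
    rw [h] at a b
    simp only [lt_self_iff_false, false_iff, not_lt] at a b
    exact le_antisymm b a

/-- The key of the standardization. -/
def stdKey (T : ℕ → ℕ → ℕ) (c : ℕ × ℕ) : ℕ ×ₗ (ℕ ×ₗ ℕ) :=
  toLex (T c.1 c.2, toLex (c.2, c.1))

theorem std_eq_rank (μ : YoungDiagram) (T : ℕ → ℕ → ℕ) : stdEntry μ T = rankT μ (stdKey T) := by
  funext i j
  unfold stdEntry rankT
  split_ifs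
  · congr 1
    apply Finset.filter_congr
    intro c _
    simp only [stdKey, Prod.Lex.toLex_le_toLex]
    tauto
  · rfl

theorem stdKey_lt (T : ℕ → ℕ → ℕ) (c d : ℕ × ℕ) : stdKey T c < stdKey T d ↔
    T c.1 c.2 < T d.1 d.2 ∨ (T c.1 c.2 = T d.1 d.2 ∧ (c.2 < d.2 ∨ (c.2 = d.2 ∧ c.1 < d.1))) := by
  simp only [stdKey, Prod.Lex.toLex_lt_toLex]

theorem std_SYT {μ : YoungDiagram} {w : Equiv.Perm ℕ} {T : ℕ → ℕ → ℕ} (hT : T ∈ EGset μ w) :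
    stdEntry μ T ∈ SYTset μ := by
  rw [std_eq_rank]
  apply rankT_SYT
  · intro i j1 j2 h hc
    rw [stdKey_lt]
    exact Or.inl (hT.1 i j1 j2 h hc)
  · intro i1 i2 j h hc
    rw [stdKey_lt]
    exact Or.inl (hT.2.1 i1 i2 j h hc)
  · intro c _ d _ h
    have a := stdKey_lt T c d
    have b := stdKey_lt T d c
    rw [h] at a b
    simp only [lt_self_iff_false, false_iff] at a b
    ext <;> omega

theorem std_RO {μ : YoungDiagram} {w : Equiv.Perm ℕ} {T : ℕ → ℕ → ℕ} (hT : T ∈ EGset μ w)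
    {c d : ℕ × ℕ} (hc : c ∈ μ.cells) (hd : d ∈ μ.cells) (h : RO c d) :
    T c.1 c.2 < T d.1 d.2 ↔ stdEntry μ T c.1 c.2 < stdEntry μ T d.1 d.2 := by
  rw [std_eq_rank, rankT_lt hc hd, stdKey_lt]
  constructor
  · exact Or.inl
  · rintro (h1 | ⟨h1, h2⟩)
    · exact h1
    · exfalso
      obtain ⟨i, j⟩ := c
      obtain ⟨i', j'⟩ := d
      simp only [RO] at *
      rcases h with h | ⟨rfl, h⟩
      · have a := hT.2.1 i i' j' h hd
        rcases h2 with h2 | ⟨rfl, h2⟩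
        · have b := hT.1 i j j' h2 (mem_le hd h.le le_rfl)
          omega
        · omega
      · have b := hT.1 i j' j h hc
        omega

theorem std_injOn (μ : YoungDiagram) (w : Equiv.Perm ℕ) : Set.InjOn (stdEntry μ) (EGset μ w) := by
  intro T hT T' hT' he
  set l := (cellsList μ).map fun c => (T c.1 c.2, T' c.1 c.2) with hl
  have f1 : l.map Prod.fst = readingWord μ T := by
    rw [readingWord_eq, hl, List.map_map]; rfl
  have f2 : l.map Prod.snd = readingWord μ T' := by
    rw [readingWord_eq, hl, List.map_map]; rfl
  have hM : ∃ M, ∀ p ∈ l, p.1 < M ∧ p.2 < M := by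
    refine ⟨l.toFinset.sup (fun p => p.1 + p.2) + 1, fun p hp => ?_⟩
    have := Finset.le_sup (f := fun p : ℕ × ℕ => p.1 + p.2) (List.mem_toFinset.2 hp)
    omega
  obtain ⟨M, hM⟩ := hM
  have main := std_inj M l hM (by rw [f1]; exact EGRed_of_reduced hT.2.2.2)
    (by rw [f2]; exact EGRed_of_reduced hT'.2.2.2)
    (by rw [f1, f2]; exact hT.2.2.2.1.trans hT'.2.2.2.1.symm) (by
      rw [hl, List.pairwise_map]
      refine List.Pairwise.imp_of_mem ?_ (cellsList_pairwise μ)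
      intro c d hc hd h
      rw [mem_cellsList] at hc hd
      dsimp only
      rw [std_RO hT hc hd h, std_RO hT' hc hd h, he])
  funext i j
  by_cases hc : (i, j) ∈ μ.cells
  · exact main (T i j, T' i j) (List.mem_map.2 ⟨(i, j), mem_cellsList.2 hc, rfl⟩)
  · rw [hT.2.2.1 i j hc, hT'.2.2.1 i j hc]

theorem EG_finite (μ : YoungDiagram) (w : Equiv.Perm ℕ) : (EGset μ w).Finite :=
  Set.Finite.of_injOn (fun _ hT => std_SYT hT) (std_injOn μ w) (SYT_finite μ)

theorem EG_le (μ : YoungDiagram) (w : Equiv.Perm ℕ) :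
    (EGset μ w).ncard ≤ (SYTset μ).ncard :=
  Set.ncard_le_ncard_of_injOn _ (fun _ hT => std_SYT hT) (std_injOn μ w) (SYT_finite μ)

theorem EG_surj {μ : YoungDiagram} {w : Equiv.Perm ℕ}
    (h : (EGset μ w).ncard = (SYTset μ).ncard) {U : ℕ → ℕ → ℕ} (hU : U ∈ SYTset μ) :
    ∃ T ∈ EGset μ w, stdEntry μ T = U := by
  have e : stdEntry μ '' EGset μ w = SYTset μ := by
    apply Set.eq_of_subset_of_ncard_le
    · rintro _ ⟨T, hT, rfl⟩
      exact std_SYT hT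
    · rw [(std_injOn μ w).ncard_image, h]
    · exact SYT_finite μ
  rw [← e] at hU
  obtain ⟨T, hT, rfl⟩ := hU
  exact ⟨T, hT, rfl⟩

/-! ### Totally commutative elements are maximal -/

theorem EGs_comm {a b : ℕ} (h : 2 ≤ Nat.dist a b) : Commute (EGs a) (EGs b) := by
  have : a + 2 ≤ b ∨ b + 2 ≤ a := by
    unfold Nat.dist at h; omega
  apply Equiv.ext
  intro y
  simp only [Equiv.Perm.mul_apply, EGs_apply]
  split_ifs <;> omega

theorem part2 {μ : YoungDiagram} {w : Equiv.Perm ℕ} (h1 : coxLength w = μ.card)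
    (h2 : TotallyCommutative w) : (SYTset μ).ncard ≤ (EGset μ w).ncard := by
  obtain ⟨l, hl, hp⟩ := h2
  have hnd : l.Nodup := hp.imp (fun {a b} h => by rintro rfl; simp [Nat.dist_self] at h)
  have hcard : l.toFinset.card = μ.card := by
    rw [List.toFinset_card_of_nodup hnd, hl.2, h1]
  set e0 := l.toFinset.orderEmbOfFin hcard with he0
  set e : ℕ → ℕ := fun k => if h : k - 1 < μ.card then e0 ⟨k - 1, h⟩ else 0 with he
  have emono : ∀ a b, 1 ≤ a → a < b → b ≤ μ.card → e a < e b := by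
    intro a b ha hab hb
    simp only [he]
    rw [dif_pos (by omega), dif_pos (by omega)]
    apply e0.strictMono
    rw [Fin.mk_lt_mk]
    omega
  have emem : ∀ a, 1 ≤ a → a ≤ μ.card → e a ∈ l.toFinset := by
    intro a ha hb
    simp only [he]
    rw [dif_pos (by omega)]
    exact Finset.orderEmbOfFin_mem _ _ _
  have einj : ∀ a b, 1 ≤ a → a ≤ μ.card → 1 ≤ b → b ≤ μ.card → e a = e b → a = b := by
    intro a b ha ha' hb hb' h
    rcases lt_trichotomy a b with h' | h' | h'
    · have := emono a b ha h' hb'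
      omega
    · exact h'
    · have := emono b a hb h' ha'
      omega
  set F : (ℕ → ℕ → ℕ) → (ℕ → ℕ → ℕ) := fun U i j =>
    if (i, j) ∈ μ.cells then e (U i j) else 0 with hF
  apply Set.ncard_le_ncard_of_injOn F _ _ (EG_finite μ w)
  · intro U hU
    have hbd := SYT_bd hU
    refine ⟨?_, ?_, ?_, ?_⟩
    · intro i j1 j2 h hc
      have hc' := mem_le hc le_rfl h.le
      simp only [hF, hc, hc', if_true]
      exact emono _ _ (hbd _ hc').1 (hU.1 i j1 j2 h hc) (hbd _ hc).2
    · intro i1 i2 j h hc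
      have hc' := mem_le hc h.le le_rfl
      simp only [hF, hc, hc', if_true]
      exact emono _ _ (hbd _ hc').1 (hU.2.1 i1 i2 j h hc) (hbd _ hc).2
    · intro i j hc
      simp only [hF, hc, if_false]
    · have nd : (readingWord μ (F U)).Nodup := by
        rw [readingWord_eq]
        apply List.Nodup.map_on _ (cellsList_nodup μ)
        intro c hc d hd h
        rw [mem_cellsList] at hc hd
        simp only [hF, hc, hd, if_true] at h
        exact SYT_inj hU c hc d hd
          (einj _ _ (hbd c hc).1 (hbd c hc).2 (hbd d hd).1 (hbd d hd).2 h)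
      have len : (readingWord μ (F U)).length = μ.card := by
        rw [readingWord_eq, List.length_map, cellsList_length]
      have perm : l.Perm (readingWord μ (F U)) := by
        apply List.perm_of_nodup_nodup_toFinset_eq hnd nd
        symm
        apply Finset.eq_of_subset_of_card_le
        · intro x hx
          rw [List.mem_toFinset, readingWord_eq, List.mem_map] at hx
          obtain ⟨c, hc, rfl⟩ := hx
          rw [mem_cellsList] at hc
          simp only [hF, hc, if_true]
          exact emem _ (hbd c hc).1 (hbd c hc).2
        · rw [hcard, List.toFinset_card_of_nodup nd, len]
      constructor
      · rw [← hl.1]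
        symm
        apply List.Perm.prod_eq' (perm.map EGs)
        rw [List.pairwise_map]
        exact hp.imp (fun h => EGs_comm h)
      · rw [len, h1]
  · intro U hU V hV h
    funext i j
    by_cases hc : (i, j) ∈ μ.cells
    · have := congrFun (congrFun h i) j
      simp only [hF, hc, if_true] at this
      exact einj _ _ (SYT_bd hU _ hc).1 (SYT_bd hU _ hc).2 (SYT_bd hV _ hc).1 (SYT_bd hV _ hc).2 this
    · rw [hU.2.2.1 i j hc, hV.2.2.1 i j hc]

/-! ### Words with distinct letters -/

theorem EGP_le {x : ℕ} : ∀ {b : List ℕ}, x ∉ b → ∀ y, (EGP b y ≤ x ↔ y ≤ x) := by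
  intro b
  induction b with
  | nil => intro _ y; rfl
  | cons z b ih =>
    intro h y
    rw [List.mem_cons, not_or] at h
    rw [← ih h.2 y, EGP_cons, Equiv.Perm.mul_apply, EGs_apply]
    have := h.1
    split_ifs <;> omega

theorem EGP_cross {x : ℕ} {u v : List ℕ} (hu : x ∉ u) (hv : x ∉ v) :
    ∃ y ≤ x, x < EGP (u ++ x :: v) y := by
  refine ⟨(EGP v).symm x, ?_, ?_⟩
  · rw [← EGP_le hv]; simp
  · rw [EGP_append, EGP_cons, Equiv.Perm.mul_apply, Equiv.Perm.mul_apply, Equiv.apply_symm_apply,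
      EGs_apply, if_pos rfl]
    have := EGP_le hu (x + 1)
    omega

theorem perm_of_nodup {a b : List ℕ} (ha : a.Nodup) (he : EGP a = EGP b)
    (hlen : b.length = a.length) : a.Perm b := by
  have hs : a ⊆ b := by
    intro x hx
    by_contra hb
    obtain ⟨u, v, rfl⟩ := List.append_of_mem hx
    rw [List.nodup_middle, List.nodup_cons, List.mem_append, not_or] at ha
    obtain ⟨y, h1, h2⟩ := EGP_cross ha.1.1 ha.1.2
    rw [he] at h2
    have := EGP_le hb y
    omega
  exact (List.subperm_of_subset ha hs).perm_of_length_le hlen.le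

theorem ord1 {x : ℕ} {u v1 v2 : List ℕ} (h : (u ++ x :: (v1 ++ (x+1) :: v2)).Nodup) :
    ∃ t ≥ x + 2, EGP (u ++ x :: (v1 ++ (x+1) :: v2)) t ≤ x := by
  have h' := h
  rw [List.nodup_middle, List.nodup_cons] at h'
  simp only [List.mem_append, List.mem_cons, not_or] at h'
  obtain ⟨⟨a1, a2, -, a3⟩, h'⟩ := h'
  rw [← List.append_assoc, List.nodup_middle, List.nodup_cons] at h'
  simp only [List.mem_append, not_or] at h'
  obtain ⟨⟨⟨b1, b2⟩, b3⟩, -⟩ := h'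
  refine ⟨(EGP v2).symm (x + 2), ?_, ?_⟩
  · have := EGP_le b3 ((EGP v2).symm (x + 2))
    rw [Equiv.apply_symm_apply] at this
    omega
  · simp only [EGP_append, EGP_cons, Equiv.Perm.mul_apply, Equiv.apply_symm_apply]
    have e1 : EGs (x+1) (x+2) = x + 1 := by
      rw [EGs_apply]; split_ifs <;> omega
    have e2 : EGP v1 (x+1) = x + 1 := by
      have p := EGP_le a2 (x+1)
      have q := EGP_le b2 (x+1)
      omega
    have e3 : EGs x (x+1) = x := by
      rw [EGs_apply]; split_ifs <;> omega
    rw [e1, e2, e3, EGP_le a1]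

theorem ord2 {x : ℕ} {u v1 v2 : List ℕ} (h : (u ++ (x+1) :: (v1 ++ x :: v2)).Nodup) :
    ∀ t ≥ x + 2, x < EGP (u ++ (x+1) :: (v1 ++ x :: v2)) t := by
  have h' := h
  rw [List.nodup_middle, List.nodup_cons] at h'
  simp only [List.mem_append, List.mem_cons, not_or] at h'
  obtain ⟨⟨a1, a2, -, a3⟩, h'⟩ := h'
  rw [← List.append_assoc, List.nodup_middle, List.nodup_cons] at h'
  simp only [List.mem_append, not_or] at h'
  obtain ⟨⟨⟨b1, b2⟩, b3⟩, -⟩ := h'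
  intro t ht
  simp only [EGP_append, EGP_cons, Equiv.Perm.mul_apply]
  have p1 := EGP_le a3 t
  generalize EGP v2 t = t1 at *
  have e1 : EGs x t1 = t1 := by
    rw [EGs_apply]; split_ifs <;> omega
  rw [e1]
  have p2 := EGP_le a2 t1
  generalize EGP v1 t1 = t2 at *
  have p3 : x + 1 ≤ EGs (x+1) t2 := by
    rw [EGs_apply]; split_ifs <;> omega
  have p4 := EGP_le b1 (EGs (x+1) t2)
  omega

theorem list_split {α : Type} {R : α → α → Prop} (hi : ∀ c, ¬ R c c)
    (ha : ∀ c d, R c d → ¬ R d c) {L : List α} (hL : L.Pairwise R) {c d : α} (hc : c ∈ L)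
    (hd : d ∈ L) (h : R c d) : ∃ u v1 v2, L = u ++ c :: (v1 ++ d :: v2) := by
  obtain ⟨u, v, rfl⟩ := List.append_of_mem hc
  rw [List.pairwise_append] at hL
  rcases List.mem_append.1 hd with hd | hd
  · exact absurd (hL.2.2 d hd c (by simp)) (ha _ _ h)
  · rcases List.mem_cons.1 hd with rfl | hd
    · exact absurd h (hi _)
    · obtain ⟨v1, v2, rfl⟩ := List.append_of_mem hd
      exact ⟨u, v1, v2, rfl⟩

theorem cell_order {μ : YoungDiagram} {T : ℕ → ℕ → ℕ} (hn : (readingWord μ T).Nodup)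
    {c d : ℕ × ℕ} (hc : c ∈ μ.cells) (hd : d ∈ μ.cells) {x : ℕ} (h1 : T c.1 c.2 = x)
    (h2 : T d.1 d.2 = x + 1) : RO c d ↔ ∃ t ≥ x + 2, EGP (readingWord μ T) t ≤ x := by
  rw [readingWord_eq] at *
  constructor
  · intro h
    obtain ⟨u, v1, v2, e⟩ := list_split RO_irrefl (fun _ _ => RO_asymm) (cellsList_pairwise μ)
      (mem_cellsList.2 hc) (mem_cellsList.2 hd) h
    rw [e] at hn ⊢
    simp only [List.map_append, List.map_cons, h1, h2] at hn ⊢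
    exact ord1 hn
  · rintro ⟨t, ht, hx⟩
    by_contra h
    have hne : c ≠ d := by rintro rfl; omega
    have h := (RO_total hne).resolve_left h
    obtain ⟨u, v1, v2, e⟩ := list_split RO_irrefl (fun _ _ => RO_asymm) (cellsList_pairwise μ)
      (mem_cellsList.2 hd) (mem_cellsList.2 hc) h
    rw [e] at hn hx
    simp only [List.map_append, List.map_cons, h1, h2] at hn hx
    have := ord2 hn t ht
    omega

/-! ### Swapping consecutive labels of standard tableaux -/

theorem SYT_swap {μ : YoungDiagram} {U : ℕ → ℕ → ℕ} (hU : U ∈ SYTset μ) {c d : ℕ × ℕ}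
    (hc : c ∈ μ.cells) (hd : d ∈ μ.cells) {k : ℕ} (h1 : U c.1 c.2 = k) (h2 : U d.1 d.2 = k + 1)
    (hr : c.1 ≠ d.1) (hcol : c.2 ≠ d.2) : (fun i j => EGs k (U i j)) ∈ SYTset μ := by
  have hinj := SYT_inj hU
  have hbd := SYT_bd hU
  have b1 := hbd c hc
  have b2 := hbd d hd
  have key : ∀ p ∈ μ.cells, ∀ q ∈ μ.cells, U p.1 p.2 < U q.1 q.2 → (p.1 = q.1 ∨ p.2 = q.2) →
      EGs k (U p.1 p.2) < EGs k (U q.1 q.2) := by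
    intro p hp q hq hlt hpq
    have : ¬ (U p.1 p.2 = k ∧ U q.1 q.2 = k + 1) := by
      rintro ⟨a, b⟩
      obtain rfl := hinj p hp c hc (by omega)
      obtain rfl := hinj q hq d hd (by omega)
      tauto
    rw [EGs_apply, EGs_apply]
    split_ifs <;> omega
  apply SYT_of
  · intro i j1 j2 h hm
    exact key (i, j1) (mem_le hm le_rfl h.le) (i, j2) hm (hU.1 i j1 j2 h hm) (Or.inl rfl)
  · intro i1 i2 j h hm
    exact key (i1, j) (mem_le hm h.le le_rfl) (i2, j) hm (hU.2.1 i1 i2 j h hm) (Or.inr rfl)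
  · intro i j h
    have e := EGs_apply k 0
    rw [if_neg (by omega), if_neg (by omega)] at e
    change EGs k (U i j) = 0
    rw [hU.2.2.1 i j h, e]
  · intro p hp
    have := hbd p hp
    rw [EGs_apply]
    split_ifs <;> omega
  · intro p hp q hq h
    exact hinj p hp q hq ((EGs k).injective h)

theorem SYT_tri {μ : YoungDiagram} {U : ℕ → ℕ → ℕ} (hU : U ∈ SYTset μ) {c d : ℕ × ℕ}
    (hc : c ∈ μ.cells) (hd : d ∈ μ.cells) {k : ℕ} (h1 : U c.1 c.2 = k) (h2 : U d.1 d.2 = k + 1) :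
    d = (c.1, c.2 + 1) ∨ d = (c.1 + 1, c.2) ∨ (c.1 ≠ d.1 ∧ c.2 ≠ d.2) := by
  obtain ⟨i, j⟩ := c
  obtain ⟨i', j'⟩ := d
  dsimp only at *
  by_cases hi : i = i'
  · subst hi
    left
    have hlt : j < j' := by
      by_contra h
      rcases Nat.lt_or_ge j' j with h' | h'
      · have := hU.1 i j' j h' hc
        omega
      · obtain rfl : j = j' := by omega
        omega
    by_contra hne
    have hlt2 : j + 1 < j' := by
      by_contra h
      exact hne (by rw [show j' = j + 1 by omega])
    have a := hU.1 i j (j+1) (by omega) (mem_le hd le_rfl hlt2.le)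
    have b := hU.1 i (j+1) j' hlt2 hd
    omega
  · by_cases hj : j = j'
    · subst hj
      right; left
      have hlt : i < i' := by
        by_contra h
        have := hU.2.1 i' i j (by omega) hc
        omega
      by_contra hne
      have hlt2 : i + 1 < i' := by
        by_contra h
        exact hne (by rw [show i' = i + 1 by omega])
      have a := hU.2.1 i (i+1) j (by omega) (mem_le hd hlt2.le le_rfl)
      have b := hU.2.1 (i+1) i' j hlt2 hd
      omega
    · exact Or.inr (Or.inr ⟨hi, hj⟩)

/-- `k+1` is always at relative position `(a, b)` from `k`. -/
def AdjK (μ : YoungDiagram) (a b k : ℕ) : Prop :=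
  ∀ U ∈ SYTset μ, ∀ c ∈ μ.cells, ∀ d ∈ μ.cells, U c.1 c.2 = k → U d.1 d.2 = k + 1 →
    d = (c.1 + a, c.2 + b)

theorem EGs_self (k : ℕ) : EGs k k = k + 1 := by simp [EGs]
theorem EGs_succ (k : ℕ) : EGs k (k + 1) = k := by simp [EGs]

theorem AdjK_descend {μ : YoungDiagram} {a b k : ℕ} (hab : (a = 1 ∧ b = 0) ∨ (a = 0 ∧ b = 1))
    (hk : k + 2 ≤ μ.card) (h : AdjK μ a b (k + 1)) : AdjK μ a b k := by
  intro U hU c hc d hd h1 h2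
  obtain ⟨e, he, h3⟩ := SYT_surj hU (k + 2) (by omega) hk
  have hde := h U hU d hd e he h2 (by omega)
  have hinj := SYT_inj hU
  have bad : ¬ (c.1 ≠ d.1 ∧ c.2 ≠ d.2) := by
    intro hh
    have hU' := SYT_swap hU hc hd h1 h2 hh.1 hh.2
    have e1 : EGs k (U c.1 c.2) = k + 1 := by rw [h1, EGs_self]
    have e2 : EGs k (U e.1 e.2) = k + 1 + 1 := by
      rw [h3, EGs_apply]; split_ifs <;> omega
    have := h _ hU' c hc e he e1 e2
    rw [hde, Prod.mk.injEq] at this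
    omega
  rcases SYT_tri hU hc hd h1 h2 with t | t | t
  · rcases hab with ⟨rfl, rfl⟩ | ⟨rfl, rfl⟩
    · exfalso
      subst t
      subst hde
      dsimp only at *
      have m : (c.1 + 1, c.2) ∈ μ.cells := mem_le he (by omega) (by omega)
      have p := hU.2.1 c.1 (c.1 + 1) c.2 (by omega) m
      have q := hU.1 (c.1 + 1) c.2 (c.2 + 1) (by omega) he
      have := hinj _ m _ hd (by dsimp only; simp only [Nat.add_zero] at *; omega)
      rw [Prod.mk.injEq] at this
      omega
    · exact t
  · rcases hab with ⟨rfl, rfl⟩ | ⟨rfl, rfl⟩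
    · exact t
    · exfalso
      subst t
      subst hde
      dsimp only at *
      have m : (c.1, c.2 + 1) ∈ μ.cells := mem_le he (by omega) (by omega)
      have p := hU.1 c.1 c.2 (c.2 + 1) (by omega) m
      have q := hU.2.1 c.1 (c.1 + 1) (c.2 + 1) (by omega) he
      have := hinj _ m _ hd (by dsimp only; simp only [Nat.add_zero] at *; omega)
      rw [Prod.mk.injEq] at this
      omega
  · exact absurd t bad

theorem AdjK_one {μ : YoungDiagram} {a b : ℕ} (hab : (a = 1 ∧ b = 0) ∨ (a = 0 ∧ b = 1)) :
    ∀ k, 1 ≤ k → k + 1 ≤ μ.card → AdjK μ a b k → AdjK μ a b 1 := by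
  intro k
  induction k with
  | zero => intro h; omega
  | succ k ih =>
    intro _ h2 h3
    by_cases hk : k = 0
    · subst hk; exact h3
    · exact ih (by omega) (by omega) (AdjK_descend hab (by omega) h3)

/-- The row-by-row standard tableau. -/
def Urow (μ : YoungDiagram) : ℕ → ℕ → ℕ := rankT μ (fun c => (toLex (c.1, c.2) : ℕ ×ₗ ℕ))
/-- The column-by-column standard tableau. -/
def Ucol (μ : YoungDiagram) : ℕ → ℕ → ℕ := rankT μ (fun c => (toLex (c.2, c.1) : ℕ ×ₗ ℕ))

theorem Urow_SYT (μ : YoungDiagram) : Urow μ ∈ SYTset μ := by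
  apply rankT_SYT
  · intro i j1 j2 h _
    simp [Prod.Lex.toLex_lt_toLex, h]
  · intro i1 i2 j h _
    simp [Prod.Lex.toLex_lt_toLex, h]
  · intro c _ d _ h
    exact toLex.injective h

theorem Ucol_SYT (μ : YoungDiagram) : Ucol μ ∈ SYTset μ := by
  apply rankT_SYT
  · intro i j1 j2 h _
    simp [Prod.Lex.toLex_lt_toLex, h]
  · intro i1 i2 j h _
    simp [Prod.Lex.toLex_lt_toLex, h]
  · intro c _ d _ h
    have := toLex.injective h
    rw [Prod.mk.injEq] at this
    exact Prod.ext this.2 this.1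

theorem SYT_zero {μ : YoungDiagram} {U : ℕ → ℕ → ℕ} (hU : U ∈ SYTset μ) (h0 : (0, 0) ∈ μ.cells) :
    U 0 0 = 1 := by
  have hc : 1 ≤ μ.card := Finset.card_pos.2 ⟨_, h0⟩
  obtain ⟨⟨i, j⟩, hm, h⟩ := SYT_surj hU 1 le_rfl hc
  have b := SYT_bd hU _ h0
  dsimp only at *
  have p : U 0 0 ≤ U 0 j := by
    rcases Nat.eq_zero_or_pos j with rfl | hj
    · exact le_rfl
    · exact (hU.1 0 0 j hj (mem_le hm (Nat.zero_le _) le_rfl)).le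
  have q : U 0 j ≤ U i j := by
    rcases Nat.eq_zero_or_pos i with rfl | hi
    · exact le_rfl
    · exact (hU.2.1 0 i j hi hm).le
  omega

theorem no_adj {μ : YoungDiagram} (hr : (1, 0) ∈ μ.cells) (hc : (0, 1) ∈ μ.cells) {k : ℕ}
    (h1 : 1 ≤ k) (h2 : k + 1 ≤ μ.card) : ¬ AdjK μ 1 0 k ∧ ¬ AdjK μ 0 1 k := by
  have h0 : (0, 0) ∈ μ.cells := mem_le hr (Nat.zero_le _) le_rfl
  constructor
  · intro h
    have h := AdjK_one (Or.inl ⟨rfl, rfl⟩) k h1 h2 h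
    have hU := Urow_SYT μ
    have z := SYT_zero hU h0
    obtain ⟨d, hd, hd2⟩ := SYT_surj hU 2 (by omega) (by omega)
    have := h _ hU _ h0 d hd z hd2
    subst this
    have p : Urow μ 0 1 < Urow μ 1 0 :=
      (rankT_lt (c := (0, 1)) (d := (1, 0)) hc hr).2 (by simp [Prod.Lex.toLex_lt_toLex])
    have q := hU.1 0 0 1 (by omega) hc
    simp only [Nat.zero_add] at hd2
    omega
  · intro h
    have h := AdjK_one (Or.inr ⟨rfl, rfl⟩) k h1 h2 h
    have hU := Ucol_SYT μ
    have z := SYT_zero hU h0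
    obtain ⟨d, hd, hd2⟩ := SYT_surj hU 2 (by omega) (by omega)
    have := h _ hU _ h0 d hd z hd2
    subst this
    have p : Ucol μ 1 0 < Ucol μ 0 1 :=
      (rankT_lt (c := (1, 0)) (d := (0, 1)) hr hc).2 (by simp [Prod.Lex.toLex_lt_toLex])
    have q := hU.2.1 0 1 0 (by omega) hr
    simp only [Nat.zero_add] at hd2
    omega

/-- The reading order of consecutive labels is not constant. -/
theorem no_const_order {μ : YoungDiagram} (hr : (1, 0) ∈ μ.cells) (hc : (0, 1) ∈ μ.cells) {k : ℕ}
    (h1 : 1 ≤ k) (h2 : k + 1 ≤ μ.card) (P : Prop)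
    (h : ∀ U ∈ SYTset μ, ∀ c ∈ μ.cells, ∀ d ∈ μ.cells, U c.1 c.2 = k → U d.1 d.2 = k + 1 →
      (RO c d ↔ P)) : False := by
  have bad : ∀ U ∈ SYTset μ, ∀ c ∈ μ.cells, ∀ d ∈ μ.cells, U c.1 c.2 = k → U d.1 d.2 = k + 1 →
      ¬ (c.1 ≠ d.1 ∧ c.2 ≠ d.2) := by
    intro U hU c hc d hd a b hh
    have hU' := SYT_swap hU hc hd a b hh.1 hh.2
    have p := h U hU c hc d hd a b
    have q := h _ hU' d hd c hc (by rw [b, EGs_succ]) (by rw [a, EGs_self])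
    have hne : c ≠ d := by rintro rfl; exact hh.1 rfl
    rcases RO_total hne with r | r
    · exact RO_asymm r (q.2 (p.1 r))
    · exact RO_asymm r (p.2 (q.1 r))
  by_cases hP : P
  · apply (no_adj hr hc h1 h2).1
    intro U hU c hc d hd a b
    rcases SYT_tri hU hc hd a b with t | t | t
    · have := (h U hU c hc d hd a b).2 hP
      subst t
      simp [RO] at this
    · exact t
    · exact absurd t (bad U hU c hc d hd a b)
  · apply (no_adj hr hc h1 h2).2
    intro U hU c hc d hd a b
    rcases SYT_tri hU hc hd a b with t | t | t
    · exact t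
    · exfalso
      apply hP
      rw [← h U hU c hc d hd a b]
      subst t
      simp [RO]
    · exact absurd t (bad U hU c hc d hd a b)

/-! ### Maximality implies total commutativity -/

theorem std_of_nodup {μ : YoungDiagram} {T : ℕ → ℕ → ℕ} (hn : (readingWord μ T).Nodup)
    {c : ℕ × ℕ} (hc : c ∈ μ.cells) :
    stdEntry μ T c.1 c.2 = ((readingWord μ T).toFinset.filter (· ≤ T c.1 c.2)).card := by
  rw [readingWord_eq] at *
  have hinj : ∀ p ∈ μ.cells, ∀ q ∈ μ.cells, T p.1 p.2 = T q.1 q.2 → p = q := by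
    intro p hp q hq h
    exact List.inj_on_of_nodup_map hn (mem_cellsList.2 hp) (mem_cellsList.2 hq) h
  have e : ((cellsList μ).map fun c => T c.1 c.2).toFinset =
      μ.cells.image fun c => T c.1 c.2 := by
    ext x
    simp only [List.mem_toFinset, List.mem_map, Finset.mem_image, mem_cellsList]
  rw [e, Finset.filter_image, Finset.card_image_of_injOn]
  · simp only [stdEntry, hc, if_true]
    congr 1
    apply Finset.filter_congr
    intro d hd
    constructor
    · omega
    · intro h
      by_cases hh : T d.1 d.2 = T c.1 c.2
      · obtain rfl := hinj d hd c hc hh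
        exact Or.inr (Or.inr ⟨rfl, rfl, le_rfl⟩)
      · left; omega
  · intro p hp q hq h
    simp only [Finset.coe_filter, Set.mem_ofPred_eq] at hp hq
    exact hinj p hp.1 q hq.1 h

theorem part3 {μ : YoungDiagram} (hr : (1, 0) ∈ μ.cells) (hc : (0, 1) ∈ μ.cells)
    {w : Equiv.Perm ℕ} (h : (EGset μ w).ncard = (SYTset μ).ncard) :
    coxLength w = μ.card ∧ TotallyCommutative w := by
  obtain ⟨T0, hT0, hs0⟩ := EG_surj h (Urow_SYT μ)
  have len : ∀ T, (readingWord μ T).length = μ.card := by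
    intro T
    rw [readingWord_eq, List.length_map, cellsList_length]
  have hcox : coxLength w = μ.card := by rw [← hT0.2.2.2.2, len]
  have hn0 : (readingWord μ T0).Nodup := by
    rw [readingWord_eq]
    apply List.Nodup.map_on _ (cellsList_nodup μ)
    have key : ∀ c ∈ μ.cells, ∀ d ∈ μ.cells, c.1 < d.1 → T0 c.1 c.2 < T0 d.1 d.2 := by
      intro c hc d hd hlt
      rw [std_RO hT0 hc hd (Or.inl hlt), hs0, Urow, rankT_lt hc hd, Prod.Lex.toLex_lt_toLex]
      exact Or.inl hlt
    intro c hc d hd he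
    rw [mem_cellsList] at hc hd
    have a := key c hc d hd
    have b := key d hd c hc
    obtain ⟨i, j⟩ := c
    obtain ⟨i', j'⟩ := d
    dsimp only at *
    obtain rfl : i = i' := by omega
    have a := hT0.1 i j j'
    have b := hT0.1 i j' j
    rcases lt_trichotomy j j' with t | rfl | t
    · have := a t hd
      omega
    · rfl
    · have := b t hc
      omega
  have hperm : ∀ T ∈ EGset μ w, (readingWord μ T0).Perm (readingWord μ T) := by
    intro T hT
    apply perm_of_nodup hn0
    · exact hT0.2.2.2.1.trans hT.2.2.2.1.symm
    · rw [len, len]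
  have hno : ∀ x, x ∈ readingWord μ T0 → x + 1 ∈ readingWord μ T0 → False := by
    intro x hx hx1
    set S := (readingWord μ T0).toFinset with hS
    have hcS : S.card = μ.card := by rw [hS, List.toFinset_card_of_nodup hn0, len]
    set k := (S.filter (· ≤ x)).card with hk
    have hxS : x ∈ S := List.mem_toFinset.2 hx
    have hx1S : x + 1 ∈ S := List.mem_toFinset.2 hx1
    have hk1 : 1 ≤ k := Finset.card_pos.2 ⟨x, by simp [hxS]⟩
    have hk2 : (S.filter (· ≤ x + 1)).card = k + 1 := by
      have : S.filter (· ≤ x + 1) = insert (x + 1) (S.filter (· ≤ x)) := by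
        ext y
        simp only [Finset.mem_filter, Finset.mem_insert]
        constructor
        · rintro ⟨a, b⟩
          by_cases hy : y = x + 1
          · exact Or.inl hy
          · exact Or.inr ⟨a, by omega⟩
        · rintro (rfl | ⟨a, b⟩)
          · exact ⟨hx1S, le_rfl⟩
          · exact ⟨a, by omega⟩
      rw [this, Finset.card_insert_of_notMem (by simp)]
    have hk3 : k + 1 ≤ μ.card := by
      rw [← hk2, ← hcS]; exact Finset.card_filter_le _ _
    apply no_const_order hr hc hk1 hk3 (∃ t ≥ x + 2, w t ≤ x)
    intro U hU c hc d hd h1 h2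
    obtain ⟨T, hT, rfl⟩ := EG_surj h hU
    have hp := hperm T hT
    have hn := hp.nodup_iff.1 hn0
    have hw : EGP (readingWord μ T) = w := hT.2.2.2.1
    have hS' : (readingWord μ T).toFinset = S := (List.toFinset_eq_of_perm _ _ hp).symm
    have hex : ∀ y ∈ S, ∃ p ∈ μ.cells, T p.1 p.2 = y := by
      intro y hy
      rw [← hS', List.mem_toFinset, readingWord_eq, List.mem_map] at hy
      obtain ⟨p, hp, e⟩ := hy
      exact ⟨p, mem_cellsList.1 hp, e⟩
    obtain ⟨c', hc', e1⟩ := hex x hxS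
    obtain ⟨d', hd', e2⟩ := hex (x + 1) hx1S
    have f1 := std_of_nodup hn hc'
    have f2 := std_of_nodup hn hd'
    rw [hS', e1] at f1
    rw [hS', e2, hk2] at f2
    obtain rfl := SYT_inj hU c hc c' hc' (by rw [h1, f1])
    obtain rfl := SYT_inj hU d hd d' hd' (by rw [h2, f2])
    rw [← hw]
    exact cell_order hn hc hd e1 e2
  refine ⟨hcox, readingWord μ T0, hT0.2.2.2, ?_⟩
  refine List.Pairwise.imp_of_mem ?_ hn0
  intro a b ha hb hab
  by_contra hd
  unfold Nat.dist at hd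
  have : b = a + 1 ∨ a = b + 1 := by omega
  rcases this with rfl | rfl
  · exact hno _ ha hb
  · exact hno _ hb ha

/-- For a shape with at least two rows and two columns, `w` is `λ`-maximal iff
`ℓ(w) = |λ|` and `w` is totally commutative. -/
theorem stmt18 (μ : YoungDiagram) (hrows : 2 ≤ μ.colLen 0) (hcols : 2 ≤ μ.rowLen 0)
    (w : Equiv.Perm ℕ) (hw : ∃ l : List ℕ, (l.map EGs).prod = w) :
    (EGset μ w).ncard = (SYTset μ).ncard ↔
      coxLength w = μ.card ∧ TotallyCommutative w := by
  have hr : (1, 0) ∈ μ.cells := by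
    rw [YoungDiagram.mem_cells, YoungDiagram.mem_iff_lt_colLen]; omega
  have hc : (0, 1) ∈ μ.cells := by
    rw [YoungDiagram.mem_cells, YoungDiagram.mem_iff_lt_rowLen]; omega
  constructor
  · intro h
    exact part3 hr hc h
  · rintro ⟨h1, h2⟩
    exact le_antisymm (EG_le μ w) (part2 h1 h2)
end
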